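/- arXiv:1805.03097 — 2 statements merged into one kernel-verified Lean document; each statement's English description precedes it below -/
import Mathlib

section
/- Let q be a prime power and let φ ∈ F_q(x) be a rational function of degree 3. Then φ is a complete permutation rational function (i.e., both φ and φ + x are permutation rational functions of P¹(F_q)) if and only if 3 divides q and φ is a polynomial in F_q[x] which is a complete permutation polynomial of F_q. -/
open Polynomial

noncomputable section

open scoped Classical in
/-- The self-map of `ℙ¹(F) = F ∪ {∞}` (encoded as `Option F`, with `none` = `∞`)
induced by the rational function `f/g`, where `f, g` are coprime polynomials. -/
def ratEval {F : Type} [Field F] (f g : F[X]) : Option F → Option F := fun x =>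
  match x with
  | some a => if g.eval a ≠ 0 then some (f.eval a / g.eval a) else none
  | none =>
      if g.natDegree < f.natDegree then none
      else if f.natDegree < g.natDegree then some 0
      else some (f.leadingCoeff / g.leadingCoeff)

section PowerSums

variable {F L : Type*} [Field F] [Fintype F] [Field L] [Algebra F L]

variable (F L) in
theorem natCast_card_eq_zero : (Fintype.card F : L) = 0 := by
  rw [← map_natCast (algebraMap F L), FiniteField.cast_card_eq_zero, map_zero]

theorem sum_algebraMap_pow_eq_zero {j : ℕ} (hj : j < Fintype.card F - 1) :
    ∑ x : F, algebraMap F L x ^ j = 0 := by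
  simpa using congrArg (algebraMap F L) (FiniteField.sum_pow_lt_card_sub_one F j hj)

theorem sum_algebraMap_pow_card_sub_one :
    ∑ x : F, algebraMap F L x ^ (Fintype.card F - 1) = -1 := by
  classical
  have h1 : 1 < Fintype.card F := Fintype.one_lt_card
  have h : ∑ x : F, x ^ (Fintype.card F - 1) = -1 := by
    have h2 : ∀ x : F, x ^ (Fintype.card F - 1) = 1 - if x = 0 then 1 else 0 := by
      intro x
      split_ifs with hx
      · rw [hx, zero_pow (by omega)]; simp
      · rw [FiniteField.pow_card_sub_one_eq_one x hx]; simp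
    rw [Finset.sum_congr rfl fun x _ => h2 x]
    simp
  simpa using congrArg (algebraMap F L) h

theorem sum_algebraMap_sub_pow (θ : L) {j : ℕ} (hj : j ≤ Fintype.card F - 1) :
    ∑ x : F, (algebraMap F L x - θ) ^ j = ∑ x : F, algebraMap F L x ^ j := by
  simp only [sub_eq_add_neg _ θ, add_pow, Finset.sum_range_succ, Finset.sum_add_distrib]
  rw [Finset.sum_comm, Finset.sum_eq_zero]
  · simp
  · intro i hi
    rw [Finset.mem_range] at hi
    simp only [mul_assoc]
    rw [← Finset.sum_mul, sum_algebraMap_pow_eq_zero (by omega), zero_mul]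

theorem algebraMap_sub_ne_zero {θ : L} (hθ : θ ^ Fintype.card F ≠ θ) (x : F) :
    algebraMap F L x - θ ≠ 0 := by
  intro h
  apply hθ
  rw [← sub_eq_zero.mp h, ← map_pow, FiniteField.pow_card]

theorem algebraMap_sub_pow_card (θ : L) (x : F) :
    (algebraMap F L x - θ) ^ Fintype.card F = algebraMap F L x - θ ^ Fintype.card F := by
  have h := map_sub (FiniteField.frobeniusAlgHom F L) (algebraMap F L x) θ
  simpa using h

theorem sum_inv_algebraMap_sub_pow {θ : L} (hθ : θ ^ Fintype.card F ≠ θ) {k : ℕ}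
    (hk : k < Fintype.card F) :
    ∑ x : F, ((algebraMap F L x - θ)⁻¹) ^ (k + 1) = ((θ ^ Fintype.card F - θ)⁻¹) ^ (k + 1) := by
  have hδ : θ ^ Fintype.card F - θ ≠ 0 := sub_ne_zero.mpr hθ
  have step : ∀ k < Fintype.card F,
      (θ ^ Fintype.card F - θ) * ∑ x : F, ((algebraMap F L x - θ)⁻¹) ^ (k + 1) =
      ∑ x : F, ((algebraMap F L x - θ)⁻¹) ^ k -
        ∑ x : F, algebraMap F L x ^ (Fintype.card F - 1 - k) := by
    intro k hk
    rw [← sum_algebraMap_sub_pow θ (by omega), Finset.mul_sum, ← Finset.sum_sub_distrib]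
    refine Finset.sum_congr rfl fun x _ => ?_
    have hy := algebraMap_sub_ne_zero hθ x
    have hpow := algebraMap_sub_pow_card θ x
    set y := algebraMap F L x - θ with hydef
    have hsplit : y ^ Fintype.card F = y ^ (Fintype.card F - 1 - k) * y ^ (k + 1) := by
      rw [← pow_add]; congr 1; omega
    have hdiff : θ ^ Fintype.card F - θ = y - y ^ (Fintype.card F - 1 - k) * y ^ (k + 1) := by
      rw [← hsplit, hpow, hydef]; ring
    rw [hdiff, inv_pow, inv_pow, sub_mul, mul_assoc, mul_inv_cancel₀ (pow_ne_zero _ hy), pow_succ]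
    field_simp
  induction k with
  | zero =>
    have h := step 0 hk
    rw [Nat.sub_zero, sum_algebraMap_pow_card_sub_one] at h
    have hc := natCast_card_eq_zero F L
    simp only [zero_add, pow_one, pow_zero, Finset.sum_const, Finset.card_univ, nsmul_eq_mul, hc,
      mul_one, zero_sub, neg_neg] at h ⊢
    exact eq_inv_of_mul_eq_one_right h
  | succ k ih =>
    have h := step (k + 1) hk
    rw [ih (by omega), sum_algebraMap_pow_eq_zero (by omega), sub_zero] at h
    rw [pow_succ _ (k + 1), ← h]
    field_simp

theorem sum_comp_bijective {h : F → F} (hh : Function.Bijective h) (k : ℕ) :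
    ∑ x : F, algebraMap F L (h x) ^ k = ∑ x : F, algebraMap F L x ^ k :=
  hh.sum_comp fun x => algebraMap F L x ^ k

theorem mul_sum_algebraMap_pow {a : F} (ha : a ≠ 0) {k : ℕ} (hk : k ≤ Fintype.card F - 1) :
    algebraMap F L a ^ k * ∑ x : F, algebraMap F L x ^ k = ∑ x : F, algebraMap F L x ^ k := by
  rcases hk.lt_or_eq with hk | rfl
  · rw [sum_algebraMap_pow_eq_zero hk, mul_zero]
  · rw [← map_pow, FiniteField.pow_card_sub_one_eq_one a ha, map_one, one_mul]

/-- If `a x + γ / (x - θ) + γ' / (x - θ ^ q)` permutes the field `F` with `q` elements, where `θ`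
is a quadratic irrationality, then `γ` is determined by `a` and `θ`. -/
theorem residue_eq_of_bijective {a : F} (ha : a ≠ 0) (hq : 2 < Fintype.card F)
    {θ γ γ' : L} (hγ : γ ≠ 0) (hθ : θ ^ Fintype.card F ≠ θ)
    (hθ2 : (θ ^ Fintype.card F) ^ Fintype.card F = θ)
    {h : F → F} (hh : Function.Bijective h)
    (hx : ∀ x, algebraMap F L (h x) = algebraMap F L a * algebraMap F L x +
      γ * (algebraMap F L x - θ)⁻¹ + γ' * (algebraMap F L x - θ ^ Fintype.card F)⁻¹) :
    γ = - algebraMap F L a * (θ ^ Fintype.card F - θ) ^ 2 := by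
  have hθ' : (θ ^ Fintype.card F) ^ Fintype.card F ≠ θ ^ Fintype.card F := by
    rw [hθ2]; exact hθ.symm
  have hδ : θ ^ Fintype.card F - θ ≠ 0 := sub_ne_zero.mpr hθ
  have s1 := sum_inv_algebraMap_sub_pow hθ (k := 0) (by omega)
  have s2 := sum_inv_algebraMap_sub_pow hθ (k := 1) (by omega)
  have s3 := sum_inv_algebraMap_sub_pow hθ (k := 2) (by omega)
  have t1 := sum_inv_algebraMap_sub_pow hθ' (k := 0) (by omega)
  have t2 := sum_inv_algebraMap_sub_pow hθ' (k := 1) (by omega)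
  have t3 := sum_inv_algebraMap_sub_pow hθ' (k := 2) (by omega)
  have hy := algebraMap_sub_ne_zero hθ
  have hy' := algebraMap_sub_ne_zero hθ'
  rw [hθ2] at t1 t2 t3
  have hδ' : θ - θ ^ Fintype.card F = -(θ ^ Fintype.card F - θ) := by ring
  rw [hδ'] at t1 t2 t3
  have hc := natCast_card_eq_zero F L
  have hx0 : ∑ x : F, algebraMap F L x = 0 := by
    simpa using sum_algebraMap_pow_eq_zero (F := F) (L := L) (j := 1) (by omega)
  have hA : algebraMap F L a ≠ 0 := by simpa using ha
  have e2 := mul_sum_algebraMap_pow (L := L) ha (k := 2) (by omega)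
  have e3 : (2 : L) = 0 → algebraMap F L a ^ 3 * ∑ x : F, algebraMap F L x ^ 3 =
      ∑ x : F, algebraMap F L x ^ 3 := by
    intro h2
    refine mul_sum_algebraMap_pow ha ?_
    have hq3 : Fintype.card F ≠ 3 := by
      intro h3
      rw [h3] at hc
      push_cast at hc
      exact one_ne_zero (α := L) (by linear_combination hc - h2)
    omega
  have p1 := sum_comp_bijective (L := L) hh 1
  have p2 := sum_comp_bijective (L := L) hh 2
  have p3 := sum_comp_bijective (L := L) hh 3
  simp only [zero_add, pow_one, Nat.reduceAdd] at s1 s2 s3 t1 t2 t3 p1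
  generalize θ ^ Fintype.card F = θ' at *
  generalize algebraMap F L a = A at *
  obtain ⟨δ, rfl⟩ : ∃ δ, θ' = θ + δ := ⟨θ' - θ, by ring⟩
  simp only [add_sub_cancel_left] at *
  have hγ' : γ' = γ := by
    simp only [hx, Finset.sum_add_distrib, ← Finset.mul_sum, s1, t1, hx0] at p1
    field_simp at p1
    linear_combination -p1
  subst hγ'
  have hXX : ∀ x : F, (algebraMap F L x - θ)⁻¹ * (algebraMap F L x - (θ + δ))⁻¹ =
      ((algebraMap F L x - (θ + δ))⁻¹ - (algebraMap F L x - θ)⁻¹) * δ⁻¹ := by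
    intro x
    have := hy x
    have := hy' x
    field_simp
    ring
  have hX : ∀ x : F, algebraMap F L x * (algebraMap F L x - θ)⁻¹ =
      1 + θ * (algebraMap F L x - θ)⁻¹ := by
    intro x
    have := hy x
    field_simp
    ring
  have hX' : ∀ x : F, algebraMap F L x * (algebraMap F L x - (θ + δ))⁻¹ =
      1 + (θ + δ) * (algebraMap F L x - (θ + δ))⁻¹ := by
    intro x
    have := hy' x
    field_simp
    ring
  by_cases h2 : (2 : L) = 0
  · have hcube : ∀ x, algebraMap F L (h x) ^ 3 = A ^ 3 * algebraMap F L x ^ 3 +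
        A ^ 2 * γ' * (δ * 1 + θ ^ 2 * (algebraMap F L x - θ)⁻¹ +
          (θ + δ) ^ 2 * (algebraMap F L x - (θ + δ))⁻¹) +
        A * γ' ^ 2 * ((algebraMap F L x - θ)⁻¹ + θ * (algebraMap F L x - θ)⁻¹ ^ 2 +
          (algebraMap F L x - (θ + δ))⁻¹ + (θ + δ) * (algebraMap F L x - (θ + δ))⁻¹ ^ 2) +
        γ' ^ 3 * ((algebraMap F L x - θ)⁻¹ ^ 3 + (algebraMap F L x - (θ + δ))⁻¹ ^ 3 +
          δ⁻¹ * ((algebraMap F L x - θ)⁻¹ ^ 2 + (algebraMap F L x - (θ + δ))⁻¹ ^ 2)) := by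
      intro x
      have k1 := hXX x
      have k2 := hX x
      have k3 := hX' x
      rw [hx]
      generalize (algebraMap F L x - θ)⁻¹ = X at *
      generalize (algebraMap F L x - (θ + δ))⁻¹ = Y at *
      generalize algebraMap F L x = z at *
      linear_combination A ^ 2 * γ' * ((z + θ) * k2 + (z + θ + δ) * k3) +
        A * γ' ^ 2 * (X * k2 + Y * k3) + γ' ^ 3 * (X + Y) * k1 +
        (A ^ 2 * γ' * (z ^ 2 * (X + Y) + z + θ) +
          A * γ' ^ 2 * (z * X ^ 2 + z * Y ^ 2 + 3 * z * X * Y) +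
          γ' ^ 3 * (X * Y * (X + Y) - X ^ 2 * δ⁻¹)) * h2
    simp only [hcube, Finset.sum_add_distrib, ← Finset.mul_sum, s1, t1, s2, t2, s3, t3, e3 h2,
      Finset.sum_const, Finset.card_univ, nsmul_eq_mul, hc] at p3
    have key : A * γ' * δ ^ 2 * (γ' + A * δ ^ 2) = 0 := by
      field_simp at p3
      linear_combination p3 +
        (A ^ 2 * γ' * δ ^ 4 + A ^ 2 * γ' * δ ^ 3 * θ - A * γ' ^ 2 * δ * θ - γ' ^ 3) * h2
    have := (mul_eq_zero.mp key).resolve_left (mul_ne_zero (mul_ne_zero hA hγ) (pow_ne_zero 2 hδ))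
    linear_combination this
  · have hsq : ∀ x, algebraMap F L (h x) ^ 2 = A ^ 2 * algebraMap F L x ^ 2 +
        2 * A * γ' * (2 * 1 + θ * (algebraMap F L x - θ)⁻¹ +
          (θ + δ) * (algebraMap F L x - (θ + δ))⁻¹) +
        γ' ^ 2 * ((algebraMap F L x - θ)⁻¹ ^ 2 + (algebraMap F L x - (θ + δ))⁻¹ ^ 2 +
          2 * δ⁻¹ * ((algebraMap F L x - (θ + δ))⁻¹ - (algebraMap F L x - θ)⁻¹)) := by
      intro x
      rw [hx]
      linear_combination 2 * A * γ' * hX x + 2 * A * γ' * hX' x + 2 * γ' ^ 2 * hXX x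
    simp only [hsq, Finset.sum_add_distrib, Finset.sum_sub_distrib, ← Finset.mul_sum, s1, t1, s2,
      t2, e2, Finset.sum_const, Finset.card_univ, nsmul_eq_mul, hc] at p2
    have key : 2 * γ' * (γ' + A * δ ^ 2) = 0 := by
      field_simp at p2
      linear_combination -p2
    have := (mul_eq_zero.mp key).resolve_left (mul_ne_zero h2 hγ)
    linear_combination this

end PowerSums
theorem exists_sq_add_mul_add_sq {F : Type*} [Field F] [Fintype F] (h3 : (3 : F) ≠ 0) (N : F) :
    ∃ u v : F, u ^ 2 + u * v + v ^ 2 = N := by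
  by_cases h2 : ringChar F = 2
  · obtain ⟨u, rfl⟩ := FiniteField.isSquare_of_char_two h2 N
    exact ⟨u, 0, by ring⟩
  · have h2' : (2 : F) ≠ 0 := Ring.two_ne_zero h2
    have hodd := FiniteField.odd_card_of_char_ne_two h2
    have d1 : degree (C (1 : F) * X ^ 2 + C 0 * X + C 0) = 2 := degree_quadratic one_ne_zero
    have d2 : degree (C (3 : F) * X ^ 2 + C 0 * X + C (-4 * N)) = 2 := degree_quadratic h3
    obtain ⟨s, t, hst⟩ := FiniteField.exists_root_sum_quadratic d1 d2 hodd
    refine ⟨(s - t) / 2, t, ?_⟩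
    simp only [eval_add, eval_mul, eval_C, eval_pow, eval_X] at hst
    field_simp
    linear_combination hst

/-- An injective cubic polynomial over a finite field of characteristic different from `3` is, up
to translations, a multiple of `X ^ 3`. -/
theorem three_mul_eq_sq_of_injective_cubic {F : Type*} [Field F] [Fintype F] (h3 : (3 : F) ≠ 0)
    {a b c d : F} (ha : a ≠ 0)
    (hf : Function.Injective fun x : F => a * x ^ 3 + b * x ^ 2 + c * x + d) :
    3 * a * c = b ^ 2 := by
  obtain ⟨u, v, huv⟩ := exists_sq_add_mul_add_sq h3 ((b ^ 2 / (3 * a) - c) / a)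
  have hval : ∀ s t : F, s ^ 2 + s * t + t ^ 2 = (b ^ 2 / (3 * a) - c) / a → s = t := by
    intro s t hst
    have := @hf (s - b / (3 * a)) (t - b / (3 * a)) (by
      field_simp at hst ⊢
      linear_combination 9 * a * (s - t) * hst)
    simpa using this
  have e1 := hval u v huv
  have e2 := hval u (-u - v) (by rw [← huv]; ring)
  subst e1
  have hu : u = 0 := (mul_eq_zero.mp (show 3 * u = 0 by linear_combination e2)).resolve_left h3
  rw [hu] at huv
  field_simp at huv
  linear_combination huv

theorem exists_algebraMap_eq_of_pow_card_eq_self {F L : Type*} [Field F] [Fintype F] [Field L]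
    [Algebra F L] {θ : L} (h : θ ^ Fintype.card F = θ) : ∃ x : F, algebraMap F L x = θ := by
  classical
  have hq : 1 < Fintype.card F := Fintype.one_lt_card
  have hp : (X ^ Fintype.card F - X : L[X]) ≠ 0 := FiniteField.X_pow_card_sub_X_ne_zero L hq
  have hsub : Finset.univ.image (algebraMap F L) ⊆
      (X ^ Fintype.card F - X : L[X]).roots.toFinset := by
    intro y hy
    obtain ⟨x, -, rfl⟩ := Finset.mem_image.mp hy
    simp [hp, ← map_pow, FiniteField.pow_card]
  have heq := Finset.eq_of_subset_of_card_le hsub (by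
    rw [Finset.card_image_of_injective _ (algebraMap F L).injective, Finset.card_univ]
    refine (Multiset.toFinset_card_le _).trans ((card_roots' _).trans ?_)
    rw [FiniteField.X_pow_card_sub_X_natDegree_eq L hq])
  have hmem : θ ∈ (X ^ Fintype.card F - X : L[X]).roots.toFinset := by
    simp [hp, h]
  rw [← heq] at hmem
  simpa using hmem

theorem exists_quadratic_conjugates {F : Type*} [Field F] [Fintype F] {m n : F}
    (hroot : ∀ x : F, x ^ 2 + m * x + n ≠ 0) :
    ∃ θ : AlgebraicClosure F, θ ^ Fintype.card F ≠ θ ∧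
      (θ ^ Fintype.card F) ^ Fintype.card F = θ ∧
      ∀ x : F, algebraMap F (AlgebraicClosure F) (x ^ 2 + m * x + n) =
        (algebraMap F _ x - θ) * (algebraMap F _ x - θ ^ Fintype.card F) := by
  set L := AlgebraicClosure F
  have hdeg : degree (C (1 : F) * X ^ 2 + C m * X + C n) = 2 := degree_quadratic one_ne_zero
  obtain ⟨θ, hθ⟩ := IsAlgClosed.exists_aeval_eq_zero L (C (1 : F) * X ^ 2 + C m * X + C n)
    (by rw [hdeg]; decide)
  have hθ' : θ ^ 2 + algebraMap F L m * θ + algebraMap F L n = 0 := by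
    simpa using hθ
  set σ := FiniteField.frobeniusAlgHom F L
  have hσ : ∀ y : L, y ^ Fintype.card F = σ y := fun y => by simp [σ]
  have hne : σ θ ≠ θ := by
    intro h
    obtain ⟨x, rfl⟩ := exists_algebraMap_eq_of_pow_card_eq_self ((hσ θ).trans h)
    apply hroot x
    apply (algebraMap F L).injective
    simpa using hθ'
  have hconj : σ θ ^ 2 + algebraMap F L m * σ θ + algebraMap F L n = 0 := by
    simpa only [map_add, map_mul, map_pow, AlgHom.commutes, map_zero] using congrArg σ hθ'
  have hsum : σ θ = - algebraMap F L m - θ := by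
    refine sub_eq_zero.mp ((mul_eq_zero.mp ?_).resolve_left (sub_ne_zero.mpr hne))
    linear_combination hconj - hθ'
  refine ⟨θ, by rwa [hσ], ?_, fun x => ?_⟩
  · rw [hσ, hσ]
    nth_rewrite 1 [hsum]
    rw [map_sub, map_neg, AlgHom.commutes, hsum]
    ring
  · rw [hσ, hsum]
    simp only [map_add, map_mul, map_pow]
    linear_combination hθ'

theorem not_bijective_linear_add_div_quadratic {F : Type*} [Field F] [Fintype F]
    {a b c d m n : F} (hroot : ∀ x : F, x ^ 2 + m * x + n ≠ 0) (ha : a ≠ 0) (ha' : a + 1 ≠ 0)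
    (hcd : c ≠ 0 ∨ d ≠ 0)
    (h : Function.Bijective fun x : F => a * x + b + (c * x + d) / (x ^ 2 + m * x + n)) :
    ¬ Function.Bijective fun x : F =>
      (a + 1) * x + b + (c * x + d) / (x ^ 2 + m * x + n) := by
  intro h'
  have hq : 2 < Fintype.card F := by
    have h1 : 1 < Fintype.card F := Fintype.one_lt_card
    by_contra! hle
    have h2 : Fintype.card F = 2 := by omega
    have e1 := FiniteField.pow_card_sub_one_eq_one a ha
    have e2 := FiniteField.pow_card_sub_one_eq_one (a + 1) ha'
    rw [h2] at e1 e2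
    exact ha (by linear_combination e2)
  obtain ⟨θ, hθ, hθ2, hfac⟩ := exists_quadratic_conjugates hroot
  have hδ : θ ^ Fintype.card F - θ ≠ 0 := sub_ne_zero.mpr hθ
  have hy := algebraMap_sub_ne_zero (F := F) hθ
  have hy' := algebraMap_sub_ne_zero (F := F) (by rw [hθ2]; exact hθ.symm)
  have hcθ : algebraMap F (AlgebraicClosure F) c * θ +
      algebraMap F (AlgebraicClosure F) d ≠ 0 := by
    intro h0
    have hc : c ≠ 0 := by
      rintro rfl
      simp_all
    have hc' : algebraMap F (AlgebraicClosure F) c ≠ 0 := by simpa using hc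
    apply hy (-d / c)
    rw [map_div₀, map_neg]
    field_simp
    linear_combination -h0
  have residue : ∀ s : F, s ≠ 0 →
      (Function.Bijective fun x : F => s * x + b + (c * x + d) / (x ^ 2 + m * x + n)) →
      -(algebraMap F (AlgebraicClosure F) c * θ + algebraMap F (AlgebraicClosure F) d) /
          (θ ^ Fintype.card F - θ) =
        - algebraMap F (AlgebraicClosure F) s * (θ ^ Fintype.card F - θ) ^ 2 := by
    intro s hs hbij
    refine residue_eq_of_bijective hs hq
      (γ' := (algebraMap F (AlgebraicClosure F) c * θ ^ Fintype.card F +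
          algebraMap F (AlgebraicClosure F) d) /
        (θ ^ Fintype.card F - θ))
      (div_ne_zero (neg_ne_zero.mpr hcθ) hδ) hθ hθ2
      (h := fun x => s * x + b + (c * x + d) / (x ^ 2 + m * x + n) - b)
      ((Equiv.subRight b).bijective.comp hbij) fun x => ?_
    have := hy x
    have := hy' x
    rw [add_right_comm, add_sub_cancel_right, map_add, map_div₀, hfac]
    simp only [map_add, map_mul]
    generalize θ ^ Fintype.card F = θ' at *
    field_simp
    ring
  have e := (residue a ha h).symm.trans (residue (a + 1) ha' h')
  rw [map_add, map_one] at e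
  exact pow_ne_zero 2 hδ (by linear_combination e)

theorem num_denom_div_of_isCoprime {F : Type*} [Field F] {p r : F[X]} (hr : r.Monic)
    (h : IsCoprime p r) :
    (algebraMap F[X] (RatFunc F) p / algebraMap F[X] (RatFunc F) r).num = p ∧
      (algebraMap F[X] (RatFunc F) p / algebraMap F[X] (RatFunc F) r).denom = r := by
  set ψ := algebraMap F[X] (RatFunc F) p / algebraMap F[X] (RatFunc F) r with hψ
  have hmul : ψ.num * r = p * ψ.denom := (RatFunc.num_mul_eq_mul_denom_iff hr.ne_zero).mpr hψ
  have hdvd : r ∣ ψ.denom := h.symm.dvd_of_dvd_mul_left ⟨ψ.num, by rw [← hmul, mul_comm]⟩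
  have hden : ψ.denom = r := eq_of_monic_of_associated (RatFunc.monic_denom ψ) hr
    (associated_of_dvd_dvd (RatFunc.denom_div_dvd p r) hdvd)
  rw [hden] at hmul
  exact ⟨mul_right_cancel₀ hr.ne_zero hmul, hden⟩

theorem num_denom_add_X {F : Type*} [Field F] (φ : RatFunc F) :
    (φ + RatFunc.X).num = φ.num + X * φ.denom ∧ (φ + RatFunc.X).denom = φ.denom := by
  have hd : algebraMap F[X] (RatFunc F) φ.denom ≠ 0 := by simp [RatFunc.denom_ne_zero]
  have hadd : φ + RatFunc.X = algebraMap F[X] (RatFunc F) (φ.num + X * φ.denom) /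
      algebraMap F[X] (RatFunc F) φ.denom := by
    conv_lhs => rw [← RatFunc.num_div_denom φ]
    rw [map_add, map_mul, RatFunc.algebraMap_X]
    field_simp
  rw [hadd]
  exact num_denom_div_of_isCoprime (RatFunc.monic_denom φ)
    (IsCoprime.add_mul_right_left φ.isCoprime_num_denom X)

section RatEval

variable {F : Type} [Field F] {f g : F[X]}

theorem ratEval_none_eq_none_iff : ratEval f g none = none ↔ g.natDegree < f.natDegree := by
  unfold ratEval
  split_ifs <;> simp_all

theorem ratEval_some_eq_none_iff {a : F} : ratEval f g (some a) = none ↔ g.eval a = 0 := by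
  simp [ratEval]

theorem ratEval_some {a : F} (h : g.eval a ≠ 0) :
    ratEval f g (some a) = some (f.eval a / g.eval a) := by
  simp [ratEval, h]

theorem bijective_eval_div_of_bijective_ratEval [Finite F] (hg : ∀ a, g.eval a ≠ 0)
    (h : Function.Injective (ratEval f g)) :
    Function.Bijective fun a : F => f.eval a / g.eval a := by
  refine Finite.injective_iff_bijective.mp fun a b hab => ?_
  have : ratEval f g (some a) = ratEval f g (some b) := by
    rw [ratEval_some (hg a), ratEval_some (hg b)]
    exact congrArg some hab
  exact Option.some.inj (h this)

theorem bijective_ratEval_one (hf : 0 < f.natDegree) (h : Function.Bijective fun a => f.eval a) :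
    Function.Bijective (ratEval f 1) := by
  have hopt : ratEval f 1 = Option.map fun a => f.eval a := by
    funext x
    cases x with
    | none => simpa using ratEval_none_eq_none_iff.mpr (by simpa using hf)
    | some a => simp [ratEval]
  rw [hopt]
  exact (Equiv.ofBijective _ h).optionCongr.bijective

/-- If `f / g` and `f / g + X` permute the projective line, then both fix the point at infinity
and have no finite pole. -/
theorem natDegree_lt_of_bijective_ratEval (hg : g ≠ 0)
    (h : Function.Bijective (ratEval f g))
    (h' : Function.Bijective (ratEval (f + X * g) g)) :
    g.natDegree < f.natDegree ∧ g.natDegree < (f + X * g).natDegree ∧ ∀ a, g.eval a ≠ 0 := by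
  have hroot : ∀ a, g.eval a ≠ 0 := by
    intro a ha
    have hle : f.natDegree ≤ g.natDegree := by
      by_contra! hlt
      have := h.injective ((ratEval_none_eq_none_iff.mpr hlt).trans
        (ratEval_some_eq_none_iff.mpr ha).symm)
      simp at this
    have hX : (X * g).natDegree = g.natDegree + 1 := natDegree_X_mul hg
    have hlt : g.natDegree < (f + X * g).natDegree := by
      rw [natDegree_add_eq_right_of_natDegree_lt (by omega)]
      omega
    have := h'.injective ((ratEval_none_eq_none_iff.mpr hlt).trans
      (ratEval_some_eq_none_iff.mpr ha).symm)
    simp at this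
  have hlt : ∀ {p : F[X]}, Function.Surjective (ratEval p g) → g.natDegree < p.natDegree := by
    intro p hp
    obtain ⟨x, hx⟩ := hp none
    cases x with
    | none => exact ratEval_none_eq_none_iff.mp hx
    | some a => exact absurd (ratEval_some_eq_none_iff.mp hx) (hroot a)
  exact ⟨hlt h.surjective, hlt h'.surjective, hroot⟩

end RatEval

theorem eval_add_X_mul_div {F : Type*} [Field F] {f g : F[X]} {a : F} (h : g.eval a ≠ 0) :
    (f + X * g).eval a / g.eval a = f.eval a / g.eval a + a := by
  rw [eval_add, eval_mul, eval_X]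
  field_simp

theorem three_eq_zero_of_bijective_cubic {F : Type*} [Field F] [Fintype F] {f : F[X]}
    (hf : f.natDegree = 3) (h : Function.Bijective fun x => f.eval x)
    (h' : Function.Bijective fun x => f.eval x + x) : (3 : F) = 0 := by
  by_contra h3
  have ha : f.coeff 3 ≠ 0 := by
    rw [← hf, coeff_natDegree, leadingCoeff_ne_zero]
    rintro rfl
    simp at hf
  have hev : ∀ x, f.eval x =
      f.coeff 3 * x ^ 3 + f.coeff 2 * x ^ 2 + f.coeff 1 * x + f.coeff 0 := by
    intro x
    rw [eval_eq_sum_range, hf]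
    simp only [Finset.sum_range_succ, Finset.sum_range_zero]
    ring
  have e1 := three_mul_eq_sq_of_injective_cubic h3 (b := f.coeff 2) (c := f.coeff 1)
    (d := f.coeff 0) ha (by simpa only [hev] using h.injective)
  have e2 := three_mul_eq_sq_of_injective_cubic h3 (b := f.coeff 2) (c := f.coeff 1 + 1)
    (d := f.coeff 0) ha (by
      convert h'.injective using 2 with x
      rw [hev]
      ring)
  exact mul_ne_zero h3 ha (by linear_combination e2 - e1)

theorem three_dvd_card_of_three_eq_zero {F : Type*} [Field F] [Fintype F] (h : (3 : F) = 0) :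
    3 ∣ Fintype.card F := by
  have : Fact (Nat.Prime 3) := ⟨Nat.prime_three⟩
  rw [← addOrderOf_eq_prime (x := (1 : F)) (p := 3) (by simpa using h) one_ne_zero]
  exact addOrderOf_dvd_card

theorem not_bijective_div_of_natDegree_eq_two {F : Type*} [Field F] [Fintype F] {f g : F[X]}
    (hf : f.natDegree = 3) (hg : g.natDegree = 2) (hmonic : g.Monic) (hcop : IsCoprime f g)
    (hfX : 2 < (f + X * g).natDegree) (hroot : ∀ a, g.eval a ≠ 0)
    (h : Function.Bijective fun x => f.eval x / g.eval x) :
    ¬ Function.Bijective fun x => f.eval x / g.eval x + x := by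
  have hdiv := modByMonic_add_div f g
  have hQ : (f /ₘ g).natDegree = 1 := by rw [natDegree_divByMonic f hmonic, hf, hg]
  have hr : (f %ₘ g).natDegree < 2 := by
    rw [← hg]
    exact natDegree_modByMonic_lt f hmonic (by rintro rfl; simp at hg)
  have hr0 : f %ₘ g ≠ 0 := by
    intro h0
    have hu : IsUnit g := hcop.symm.isUnit_of_dvd ((modByMonic_eq_zero_iff_dvd hmonic).mp h0)
    rw [natDegree_eq_zero_of_isUnit hu] at hg
    omega
  obtain ⟨a, b, hab⟩ := exists_eq_X_add_C_of_natDegree_le_one hQ.le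
  obtain ⟨c, d, hcd⟩ := exists_eq_X_add_C_of_natDegree_le_one (Nat.lt_succ_iff.mp hr)
  have ha : a ≠ 0 := by
    rintro rfl
    simp [hab] at hQ
  have hcd0 : c ≠ 0 ∨ d ≠ 0 := by
    by_contra! hzero
    apply hr0
    simp [hcd, hzero.1, hzero.2]
  have ha' : a + 1 ≠ 0 := by
    intro h0
    have hX : f + X * g = f %ₘ g + C b * g := by
      have : C a + 1 = 0 := by rw [← C_1, ← C_add, h0, C_0]
      conv_lhs => rw [← hdiv]
      rw [hab]
      linear_combination X * g * this
    have hle : (f %ₘ g + C b * g).natDegree ≤ 2 :=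
      natDegree_add_le_of_degree_le hr.le ((natDegree_C_mul_le b g).trans hg.le)
    rw [hX] at hfX
    omega
  have hgev : ∀ x, g.eval x = x ^ 2 + g.coeff 1 * x + g.coeff 0 := by
    intro x
    have h2 : g.coeff 2 = 1 := by rw [← hg]; exact hmonic
    rw [eval_eq_sum_range, hg]
    simp only [Finset.sum_range_succ, Finset.sum_range_zero, h2]
    ring
  have hfev : ∀ x, f.eval x / g.eval x =
      a * x + b + (c * x + d) / (x ^ 2 + g.coeff 1 * x + g.coeff 0) := by
    intro x
    have h0 := hroot x
    have hx := congrArg (eval x) hdiv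
    rw [hab, hcd] at hx
    simp only [eval_add, eval_mul, eval_C, eval_X] at hx
    rw [← hgev, ← hx]
    field_simp
    ring
  have hfev' : ∀ x, f.eval x / g.eval x + x =
      (a + 1) * x + b + (c * x + d) / (x ^ 2 + g.coeff 1 * x + g.coeff 0) := by
    intro x
    rw [hfev]
    ring
  simp only [hfev']
  exact not_bijective_linear_add_div_quadratic (fun x => hgev x ▸ hroot x) ha ha' hcd0
    (by simpa only [hfev] using h)

theorem stmt_16 (F : Type) [Field F] [Fintype F] (φ : RatFunc F)
    (hdeg : max φ.num.natDegree φ.denom.natDegree = 3) :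
    (Function.Bijective (ratEval φ.num φ.denom) ∧
      Function.Bijective (ratEval (φ + RatFunc.X).num (φ + RatFunc.X).denom)) ↔
    (3 ∣ Fintype.card F ∧ ∃ f : F[X], φ = algebraMap F[X] (RatFunc F) f ∧
      Function.Bijective (fun x : F => f.eval x) ∧
      Function.Bijective (fun x : F => f.eval x + x)) := by
  obtain ⟨hnum, hden⟩ := num_denom_add_X φ
  rw [hnum, hden]
  constructor
  · rintro ⟨h1, h2⟩
    obtain ⟨hlt, hlt', hroot⟩ := natDegree_lt_of_bijective_ratEval (RatFunc.denom_ne_zero φ) h1 h2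
    have b1 := bijective_eval_div_of_bijective_ratEval hroot h1.injective
    have b2 := bijective_eval_div_of_bijective_ratEval hroot h2.injective
    simp only [fun a => eval_add_X_mul_div (f := φ.num) (hroot a)] at b2
    have hf : φ.num.natDegree = 3 := by omega
    have hg : φ.denom.natDegree < 3 := by omega
    interval_cases hgd : φ.denom.natDegree
    · have hone : φ.denom = 1 := (RatFunc.monic_denom φ).natDegree_eq_zero.mp hgd
      simp only [hone, eval_one, div_one] at b1 b2
      refine ⟨three_dvd_card_of_three_eq_zero (three_eq_zero_of_bijective_cubic hf b1 b2),
        φ.num, ?_, b1, b2⟩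
      conv_lhs => rw [← RatFunc.num_div_denom φ, hone, map_one, div_one]
    · obtain ⟨a, ha⟩ := exists_root_of_degree_eq_one
        ((degree_eq_iff_natDegree_eq (RatFunc.denom_ne_zero φ)).mpr hgd)
      exact absurd ha (hroot a)
    · exact absurd b2 (not_bijective_div_of_natDegree_eq_two hf hgd (RatFunc.monic_denom φ)
        φ.isCoprime_num_denom hlt' hroot b1)
  · rintro ⟨-, f, rfl, h1, h2⟩
    rw [RatFunc.num_algebraMap, RatFunc.denom_algebraMap, natDegree_one] at hdeg
    rw [RatFunc.num_algebraMap, RatFunc.denom_algebraMap, mul_one]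
    have hf : f.natDegree = 3 := by omega
    refine ⟨bijective_ratEval_one (by omega) h1, bijective_ratEval_one ?_ (by simpa using h2)⟩
    rw [natDegree_add_eq_left_of_natDegree_lt] <;> simp [hf]

end
end

section
/- Let q be a prime power and let φ ∈ F_q(x) be a rational function of degree 3. Then φ induces a permutation of P¹(F_q) if and only if φ induces a permutation of P¹(F_{q^n}) for infinitely many positive integers n. -/
open Polynomial

noncomputable section

/-- The Lucas-type sequence with value `y ^ k + y' ^ k` at `b = -(y + y')`, `n = y * y'`. -/
def traceSeq {R : Type*} [CommRing R] (b n : R) : ℕ → R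
  | 0 => 2
  | 1 => -b
  | k + 2 => -b * traceSeq b n (k + 1) - n * traceSeq b n k

theorem traceSeq_eq {R : Type*} [CommRing R] {b n y y' : R} (hb : b = -(y + y'))
    (hn : n = y * y') : ∀ k, traceSeq b n k = y ^ k + y' ^ k
  | 0 => by simp [traceSeq]; norm_num
  | 1 => by simp [traceSeq, hb]
  | k + 2 => by
    rw [traceSeq, traceSeq_eq hb hn (k + 1), traceSeq_eq hb hn k, hb, hn]
    ring

theorem map_traceSeq {R S : Type*} [CommRing R] [CommRing S] (f : R →+* S) (b n : R) :
    ∀ k, f (traceSeq b n k) = traceSeq (f b) (f n) k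
  | 0 => by simp [traceSeq, map_ofNat]
  | 1 => by simp [traceSeq]
  | k + 2 => by
    simp [traceSeq, map_traceSeq f b n (k + 1), map_traceSeq f b n k]

theorem natDegree_traceSeq_le {R : Type*} [CommRing R] {b n : R[X]} (hb : b.natDegree ≤ 2)
    (hn : n.natDegree ≤ 4) : ∀ k, (traceSeq b n k).natDegree ≤ 2 * k
  | 0 => by simp [traceSeq]
  | 1 => by simpa [traceSeq] using hb
  | k + 2 => by
    rw [traceSeq]
    have h1 := natDegree_mul_le_of_le (natDegree_neg_le_of_le hb)
      (natDegree_traceSeq_le hb hn (k + 1))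
    have h2 := natDegree_mul_le_of_le hn (natDegree_traceSeq_le hb hn k)
    exact (natDegree_sub_le _ _).trans (max_le (h1.trans (by omega)) (h2.trans (by omega)))

theorem reflect_traceSeq {R : Type*} [CommRing R] {b n : R[X]} (hb : b.natDegree ≤ 2)
    (hn : n.natDegree ≤ 4) :
    ∀ k, reflect (2 * k) (traceSeq b n k) = traceSeq (reflect 2 b) (reflect 4 n) k
  | 0 => by
    have : (2 : R[X]) = C 2 := rfl
    simp only [traceSeq, this, reflect_C]; simp
  | 1 => by simp [traceSeq, reflect_neg]
  | k + 2 => by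
    rw [traceSeq, traceSeq, reflect_sub, ← reflect_traceSeq hb hn (k + 1),
      ← reflect_traceSeq hb hn k, ← reflect_neg,
      ← reflect_mul _ _ (natDegree_neg_le_of_le hb) (natDegree_traceSeq_le hb hn (k + 1)),
      ← reflect_mul _ _ hn (natDegree_traceSeq_le hb hn k),
      show 2 + 2 * (k + 1) = 2 * (k + 2) by ring, show 4 + 2 * k = 2 * (k + 2) by ring]

/-- The quadratic `b₀ + b₁ x + b₂ x²`. -/
def quadratic {R : Type*} [CommRing R] (b0 b1 b2 x : R) : R := b0 + b1 * x + b2 * x ^ 2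

/-- The quartic `n₀ + n₁ x + n₂ x² + n₃ x³ + n₄ x⁴`. -/
def quartic {R : Type*} [CommRing R] (n0 n1 n2 n3 n4 x : R) : R :=
  n0 + n1 * x + n2 * x ^ 2 + n3 * x ^ 3 + n4 * x ^ 4

/-- A symmetric form of bidegree `(2, 2)` restricting to twice the quartic on the diagonal. -/
def polarQuartic {R : Type*} [CommRing R] (n0 n1 n2 n3 n4 x y : R) : R :=
  2 * n0 + n1 * (x + y) + 2 * n2 * (x * y) + n3 * (x * y * (x + y)) + 2 * n4 * (x ^ 2 * y ^ 2)

/-- With `y` a root of `z² + b z + n`, the trace of `y ^ (q + 1)` minus the polarised norm. -/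
def frobDefect {F : Type*} [Field F] (q : ℕ) (b0 b1 b2 n0 n1 n2 n3 n4 : F) : F[X] :=
  traceSeq (quadratic (C b0) (C b1) (C b2) X) (quartic (C n0) (C n1) (C n2) (C n3) (C n4) X)
    (q + 1) - polarQuartic (C n0) (C n1) (C n2) (C n3) (C n4) X (X ^ q)

section

variable {F : Type*} [Field F]

theorem sq_dvd_of_dualNumber {K : Type*} [Field K] [Algebra F K] {p : F[X]} {t : F}
    (h : p.eval₂ ((TrivSqZeroExt.inlHom K K).comp (algebraMap F K))
      (TrivSqZeroExt.inl (algebraMap F K t) + TrivSqZeroExt.inr 1) = 0) : (X - C t) ^ 2 ∣ p := by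
  rcases eq_or_ne p 0 with rfl | hp
  · simp
  have h1 : aeval (algebraMap K (DualNumber K) (algebraMap F K t) + DualNumber.eps)
      (p.map (algebraMap F K)) = 0 := by
    rw [aeval_def, eval₂_map]
    exact h
  have he : ∀ r : F[X], aeval (algebraMap K (DualNumber K) (algebraMap F K t))
      (r.map (algebraMap F K)) = algebraMap K (DualNumber K) (algebraMap F K (r.eval t)) := by
    intro r
    rw [aeval_algebraMap_apply, coe_aeval_eq_eval, eval_map_apply]
  rw [aeval_add_of_sq_eq_zero _ _ _ (by simp [pow_two]), derivative_map, he, he] at h1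
  have hf := congrArg TrivSqZeroExt.fst h1
  have hs := congrArg TrivSqZeroExt.snd h1
  simp only [TrivSqZeroExt.algebraMap_eq_inl, TrivSqZeroExt.fst_add, TrivSqZeroExt.snd_add,
    TrivSqZeroExt.fst_mul, TrivSqZeroExt.snd_mul, TrivSqZeroExt.fst_inl, TrivSqZeroExt.snd_inl,
    DualNumber.fst_eps, DualNumber.snd_eps, TrivSqZeroExt.fst_zero, TrivSqZeroExt.snd_zero,
    smul_eq_mul, mul_zero, mul_one, add_zero, zero_add, smul_zero,
    map_eq_zero] at hf hs
  rw [← le_rootMultiplicity_iff hp]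
  exact (one_lt_rootMultiplicity_iff_isRoot hp).2 ⟨hf, hs⟩

theorem quadratic_reflect (b0 b1 b2 : F) :
    reflect 2 (quadratic (C b0) (C b1) (C b2) X) = quadratic (C b2) (C b1) (C b0) X := by
  have : quadratic (C b0) (C b1) (C b2) X = C b0 * X ^ 0 + C b1 * X ^ 1 + C b2 * X ^ 2 := by
    simp [quadratic]
  rw [this]
  simp only [reflect_add, reflect_C_mul_X_pow, revAt_le (show 0 ≤ 2 by norm_num),
    revAt_le (show 1 ≤ 2 by norm_num), revAt_le (show 2 ≤ 2 by norm_num), quadratic]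
  ring

theorem quartic_reflect (n0 n1 n2 n3 n4 : F) :
    reflect 4 (quartic (C n0) (C n1) (C n2) (C n3) (C n4) X) =
      quartic (C n4) (C n3) (C n2) (C n1) (C n0) X := by
  have : quartic (C n0) (C n1) (C n2) (C n3) (C n4) X =
      C n0 * X ^ 0 + C n1 * X ^ 1 + C n2 * X ^ 2 + C n3 * X ^ 3 + C n4 * X ^ 4 := by
    simp [quartic]
  rw [this]
  simp only [reflect_add, reflect_C_mul_X_pow, revAt_le (show 0 ≤ 4 by norm_num),
    revAt_le (show 1 ≤ 4 by norm_num), revAt_le (show 2 ≤ 4 by norm_num),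
    revAt_le (show 3 ≤ 4 by norm_num), revAt_le (show 4 ≤ 4 by norm_num), quartic]
  ring

theorem polarQuartic_X_pow (q : ℕ) (n0 n1 n2 n3 n4 : F) :
    polarQuartic (C n0) (C n1) (C n2) (C n3) (C n4) X (X ^ q) =
      C (2 * n0) * X ^ 0 + C n1 * X ^ 1 + C n1 * X ^ q + C (2 * n2) * X ^ (q + 1) +
        C n3 * X ^ (q + 2) + C n3 * X ^ (2 * q + 1) + C (2 * n4) * X ^ (2 * q + 2) := by
  simp only [polarQuartic, map_mul, map_ofNat]
  ring

theorem polarQuartic_reflect (q : ℕ) (n0 n1 n2 n3 n4 : F) :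
    reflect (2 * (q + 1)) (polarQuartic (C n0) (C n1) (C n2) (C n3) (C n4) X (X ^ q)) =
      polarQuartic (C n4) (C n3) (C n2) (C n1) (C n0) X (X ^ q) := by
  rw [polarQuartic_X_pow, polarQuartic_X_pow]
  simp only [reflect_add, reflect_C_mul_X_pow]
  rw [revAt_le (show 0 ≤ 2 * (q + 1) by omega), revAt_le (show 1 ≤ 2 * (q + 1) by omega),
    revAt_le (show q ≤ 2 * (q + 1) by omega), revAt_le (show q + 1 ≤ 2 * (q + 1) by omega),
    revAt_le (show q + 2 ≤ 2 * (q + 1) by omega), revAt_le (show 2 * q + 1 ≤ 2 * (q + 1) by omega),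
    revAt_le (show 2 * q + 2 ≤ 2 * (q + 1) by omega),
    show 2 * (q + 1) - 0 = 2 * q + 2 by omega, show 2 * (q + 1) - 1 = 2 * q + 1 by omega,
    show 2 * (q + 1) - q = q + 2 by omega, show 2 * (q + 1) - (q + 1) = q + 1 by omega,
    show 2 * (q + 1) - (q + 2) = q by omega, show 2 * (q + 1) - (2 * q + 1) = 1 by omega,
    show 2 * (q + 1) - (2 * q + 2) = 0 by omega]
  ring

theorem natDegree_quadratic_C_le (b0 b1 b2 : F) :
    (quadratic (C b0) (C b1) (C b2) X).natDegree ≤ 2 := by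
  rw [quadratic]; compute_degree!

theorem natDegree_quartic_C_le (n0 n1 n2 n3 n4 : F) :
    (quartic (C n0) (C n1) (C n2) (C n3) (C n4) X).natDegree ≤ 4 := by
  rw [quartic]; compute_degree!

theorem frobDefect_reflect (q : ℕ) (b0 b1 b2 n0 n1 n2 n3 n4 : F) :
    reflect (2 * (q + 1)) (frobDefect q b0 b1 b2 n0 n1 n2 n3 n4) =
      frobDefect q b2 b1 b0 n4 n3 n2 n1 n0 := by
  rw [frobDefect, frobDefect, reflect_sub, polarQuartic_reflect,
    reflect_traceSeq (natDegree_quadratic_C_le ..) (natDegree_quartic_C_le ..), quadratic_reflect,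
    quartic_reflect]

theorem natDegree_frobDefect_le (q : ℕ) (b0 b1 b2 n0 n1 n2 n3 n4 : F) :
    (frobDefect q b0 b1 b2 n0 n1 n2 n3 n4).natDegree ≤ 2 * (q + 1) := by
  rw [frobDefect]
  refine (natDegree_sub_le _ _).trans (max_le (natDegree_traceSeq_le
    (natDegree_quadratic_C_le b0 b1 b2) (natDegree_quartic_C_le n0 n1 n2 n3 n4) _) ?_)
  have h (a : F) {k : ℕ} (hk : k ≤ 2 * (q + 1)) : (C a * X ^ k).natDegree ≤ 2 * (q + 1) :=
    (natDegree_C_mul_X_pow_le a k).trans hk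
  rw [polarQuartic_X_pow]
  exact natDegree_add_le_of_degree_le (natDegree_add_le_of_degree_le
    (natDegree_add_le_of_degree_le (natDegree_add_le_of_degree_le (natDegree_add_le_of_degree_le
    (natDegree_add_le_of_degree_le (h _ (by omega)) (h _ (by omega))) (h _ (by omega)))
    (h _ (by omega))) (h _ (by omega))) (h _ (by omega))) (h _ (by omega))

section

variable [Fintype F]

theorem mem_range_of_pow_card_eq {K : Type*} [Field K] [Algebra F K] {y : K}
    (hy : y ^ Fintype.card F = y) : y ∈ (algebraMap F K).range := by
  have hsp : (X ^ Fintype.card F - X : F[X]).Splits := by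
    rw [splits_iff_card_roots, FiniteField.roots_X_pow_card_sub_X,
      FiniteField.X_pow_card_sub_X_natDegree_eq F Fintype.one_lt_card]
    rfl
  exact hsp.mem_range_of_isRoot (FiniteField.X_pow_card_sub_X_ne_zero F Fintype.one_lt_card)
    (by simp [hy])

theorem pow_card_ne_self {K : Type*} [Field K] [Algebra F K] {b n : F}
    (h : ∀ z : F, z ^ 2 + b * z + n ≠ 0) {y : K}
    (hy : y ^ 2 + algebraMap F K b * y + algebraMap F K n = 0) : y ^ Fintype.card F ≠ y := by
  intro hq
  obtain ⟨z, rfl⟩ := mem_range_of_pow_card_eq hq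
  apply h z
  apply (algebraMap F K).injective
  simpa using hy

theorem pow_card_eq_conj {K : Type*} [Field K] [Algebra F K] {b n : F}
    (h : ∀ z : F, z ^ 2 + b * z + n ≠ 0) {y : K}
    (hy : y ^ 2 + algebraMap F K b * y + algebraMap F K n = 0) :
    y ^ Fintype.card F = -algebraMap F K b - y := by
  have hne := pow_card_ne_self h hy
  have h2 := congrArg (FiniteField.frobeniusAlgHom F K) hy
  simp only [map_add, map_mul, map_pow, AlgHom.commutes, map_zero,
    FiniteField.frobeniusAlgHom_apply] at h2
  have : (y ^ Fintype.card F - y) * (y ^ Fintype.card F + y + algebraMap F K b) = 0 := by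
    linear_combination h2 - hy
  rcases mul_eq_zero.1 this with h3 | h3
  · exact absurd (sub_eq_zero.1 h3) hne
  · linear_combination h3

theorem X_sub_C_sq_dvd_frobDefect_of_root {K : Type*} [Field K] [Algebra F K]
    {b0 b1 b2 n0 n1 n2 n3 n4 t : F}
    (h : ∀ z : F, z ^ 2 + quadratic b0 b1 b2 t * z + quartic n0 n1 n2 n3 n4 t ≠ 0) {y : K}
    (hy : y ^ 2 + algebraMap F K (quadratic b0 b1 b2 t) * y +
      algebraMap F K (quartic n0 n1 n2 n3 n4 t) = 0) :
    (X - C t) ^ 2 ∣ frobDefect (Fintype.card F) b0 b1 b2 n0 n1 n2 n3 n4 := by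
  apply sq_dvd_of_dualNumber (K := K)
  have hyq := pow_card_eq_conj h hy
  have hyq' := pow_card_eq_conj h
    (y := -algebraMap F K (quadratic b0 b1 b2 t) - y) (by linear_combination hy)
  have hyne := pow_card_ne_self h hy
  have hq0 : ((Fintype.card F : ℕ) : K) = 0 := by
    rw [← map_natCast (algebraMap F K), FiniteField.cast_card_eq_zero, map_zero]
  have htq : algebraMap F K t ^ Fintype.card F = algebraMap F K t := by
    rw [← map_pow, FiniteField.pow_card]
  have hpow : ∀ w : DualNumber K, w ^ Fintype.card F =
      TrivSqZeroExt.inl (w.fst ^ Fintype.card F) := by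
    intro w
    ext <;> simp [hq0]
  generalize Fintype.card F = q at *
  set f := (TrivSqZeroExt.inlHom K K).comp (algebraMap F K) with hf
  have hfa : ∀ a, f a = TrivSqZeroExt.inl (algebraMap F K a) := fun a => rfl
  simp only [quadratic, quartic, map_add, map_mul, map_pow] at hy hyq hyq'
  rw [sub_sub_cancel] at hyq'
  set b0' := algebraMap F K b0
  set b1' := algebraMap F K b1
  set b2' := algebraMap F K b2
  set n0' := algebraMap F K n0
  set n1' := algebraMap F K n1
  set n2' := algebraMap F K n2
  set n3' := algebraMap F K n3
  set n4' := algebraMap F K n4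
  set s := algebraMap F K t
  set B := b0' + b1' * s + b2' * s ^ 2 with hB
  obtain ⟨y1, hy1⟩ : ∃ y1, y1 * (2 * y + B) =
      -((b1' + 2 * b2' * s) * y + (n1' + 2 * n2' * s + 3 * n3' * s ^ 2 + 4 * n4' * s ^ 3)) := by
    refine ⟨_, div_mul_cancel₀ _ ?_⟩
    intro h0
    apply hyne
    rw [hyq]
    linear_combination -h0
  obtain ⟨x, hx⟩ : ∃ x : DualNumber K, x = TrivSqZeroExt.inl s + TrivSqZeroExt.inr 1 := ⟨_, rfl⟩
  obtain ⟨Y, hY⟩ : ∃ Y : DualNumber K, Y = TrivSqZeroExt.inl y + TrivSqZeroExt.inr y1 := ⟨_, rfl⟩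
  obtain ⟨Y', hY'⟩ : ∃ Y : DualNumber K, Y = TrivSqZeroExt.inl (-B - y) +
    TrivSqZeroExt.inr (-(b1' + 2 * b2' * s) - y1) := ⟨_, rfl⟩
  have e1 : quadratic (f b0) (f b1) (f b2) x = -(Y + Y') := by
    rw [hx, hY, hY']
    ext
    · simp [quadratic, hfa]
      ring
    · simp [quadratic, hfa]
      ring
  have e2 : quartic (f n0) (f n1) (f n2) (f n3) (f n4) x = Y * Y' := by
    rw [hx, hY, hY']
    ext
    · simp [quartic, hfa]
      linear_combination hy
    · simp [quartic, hfa]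
      linear_combination hy1
  have e3 : Y ^ q = TrivSqZeroExt.inl (-B - y) := by
    rw [hpow, hY]; simp [hyq]
  have e4 : Y' ^ q = TrivSqZeroExt.inl y := by
    rw [hpow, hY']; simp [hyq']
  have e5 : x ^ q = TrivSqZeroExt.inl s := by
    rw [hpow, hx]; simp [htq]
  rw [← hx, ← coe_eval₂RingHom, frobDefect, map_sub, map_traceSeq]
  have e1' : eval₂RingHom f x (quadratic (C b0) (C b1) (C b2) X) = -(Y + Y') := by
    rw [← e1]; simp [quadratic]
  have e2' : eval₂RingHom f x (quartic (C n0) (C n1) (C n2) (C n3) (C n4) X) = Y * Y' := by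
    rw [← e2]; simp [quartic]
  rw [e1', e2', traceSeq_eq rfl rfl, pow_succ, pow_succ, e3, e4]
  have e6 : eval₂RingHom f x (polarQuartic (C n0) (C n1) (C n2) (C n3) (C n4) X (X ^ q)) =
      polarQuartic (f n0) (f n1) (f n2) (f n3) (f n4) x (x ^ q) := by
    simp only [polarQuartic, map_add, map_mul, map_pow, map_ofNat, coe_eval₂RingHom, eval₂_C,
      eval₂_X]
  have h2 : (2 : DualNumber K) = TrivSqZeroExt.inl 2 := rfl
  rw [e6, e5, hx, hY, hY']
  ext
  · simp [polarQuartic, hfa, h2]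
    linear_combination (-2) * hy
  · simp [polarQuartic, hfa, h2]
    linear_combination (-1) * hy1

theorem X_sub_C_sq_dvd_frobDefect {b0 b1 b2 n0 n1 n2 n3 n4 t : F}
    (h : ∀ z : F, z ^ 2 + quadratic b0 b1 b2 t * z + quartic n0 n1 n2 n3 n4 t ≠ 0) :
    (X - C t) ^ 2 ∣ frobDefect (Fintype.card F) b0 b1 b2 n0 n1 n2 n3 n4 := by
  obtain ⟨y, hy⟩ := IsAlgClosed.exists_aeval_eq_zero (AlgebraicClosure F)
    (X ^ 2 + C (quadratic b0 b1 b2 t) * X + C (quartic n0 n1 n2 n3 n4 t))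
    (by
      have : (X ^ 2 + C (quadratic b0 b1 b2 t) * X + C (quartic n0 n1 n2 n3 n4 t)).degree = 2 := by
        compute_degree!
      rw [this]
      decide)
  exact X_sub_C_sq_dvd_frobDefect_of_root (K := AlgebraicClosure F) h (y := y)
    (by simpa using hy)

theorem prod_X_sub_C_eq_X_pow_card_sub_X : ∏ t : F, (X - C t) = X ^ Fintype.card F - X := by
  have h := prod_multiset_X_sub_C_of_monic_of_roots_card_eq
    (p := (X ^ Fintype.card F - X : F[X])) ?_ ?_
  · rw [← h, FiniteField.roots_X_pow_card_sub_X]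
    rfl
  · exact monic_X_pow_sub (by rw [degree_X]; exact_mod_cast Fintype.one_lt_card)
  · rw [FiniteField.roots_X_pow_card_sub_X,
      FiniteField.X_pow_card_sub_X_natDegree_eq F Fintype.one_lt_card]
    rfl

theorem exists_frobDefect_eq {b0 b1 b2 n0 n1 n2 n3 n4 : F}
    (h : ∀ t z : F, z ^ 2 + quadratic b0 b1 b2 t * z + quartic n0 n1 n2 n3 n4 t ≠ 0)
    (hinf : ∀ z : F, z ^ 2 + b2 * z + n4 ≠ 0) :
    ∃ c : F, frobDefect (Fintype.card F) b0 b1 b2 n0 n1 n2 n3 n4 =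
      C c * (X ^ Fintype.card F - X) ^ 2 := by
  have hq : 1 < Fintype.card F := Fintype.one_lt_card
  have hdvd : (X ^ Fintype.card F - X) ^ 2 ∣
      frobDefect (Fintype.card F) b0 b1 b2 n0 n1 n2 n3 n4 := by
    rw [← prod_X_sub_C_eq_X_pow_card_sub_X, ← Finset.prod_pow]
    refine Finset.prod_dvd_of_coprime ?_ fun t _ => X_sub_C_sq_dvd_frobDefect (h t)
    intro s _ t _ hst
    exact (isCoprime_X_sub_C_of_isUnit_sub (sub_ne_zero.2 hst).isUnit).pow
  have hrev : X ^ 2 ∣ frobDefect (Fintype.card F) b2 b1 b0 n4 n3 n2 n1 n0 := by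
    simpa using X_sub_C_sq_dvd_frobDefect (t := (0 : F)) (b0 := b2) (b1 := b1) (b2 := b0)
      (n0 := n4) (n1 := n3) (n2 := n2) (n3 := n1) (n4 := n0)
      (by simpa [quadratic, quartic] using hinf)
  have hEdeg : (X ^ Fintype.card F - X : F[X]).natDegree = Fintype.card F :=
    FiniteField.X_pow_card_sub_X_natDegree_eq F hq
  have hE0 : (X ^ Fintype.card F - X : F[X]) ≠ 0 := FiniteField.X_pow_card_sub_X_ne_zero F hq
  have hdeg := natDegree_frobDefect_le (Fintype.card F) b0 b1 b2 n0 n1 n2 n3 n4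
  rw [← frobDefect_reflect] at hrev
  obtain ⟨r, hr⟩ := hdvd
  rw [hr] at hrev hdeg ⊢
  have hr2 : r.natDegree ≤ 2 := by
    rcases eq_or_ne r 0 with rfl | hr0
    · simp
    rw [natDegree_mul (pow_ne_zero 2 hE0) hr0, natDegree_pow, hEdeg] at hdeg
    omega
  have hErev : reflect (Fintype.card F) (X ^ Fintype.card F - X : F[X]) =
      1 - X ^ (Fintype.card F - 1) := by
    have : (X : F[X]) = X ^ 1 := (pow_one X).symm
    rw [reflect_sub, reflect_monomial, revAt_le le_rfl, this, reflect_monomial, revAt_le hq.le]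
    simp
  rw [show 2 * (Fintype.card F + 1) = Fintype.card F + Fintype.card F + 2 by ring,
    pow_two (X ^ Fintype.card F - X : F[X]),
    reflect_mul _ _ (natDegree_mul_le_of_le hEdeg.le hEdeg.le) hr2,
    reflect_mul _ _ hEdeg.le hEdeg.le, hErev] at hrev
  have hcop : IsCoprime (X : F[X]) (1 - X ^ (Fintype.card F - 1)) := by
    refine ⟨X ^ (Fintype.card F - 2), 1, ?_⟩
    rw [← pow_succ, show Fintype.card F - 2 + 1 = Fintype.card F - 1 by omega]
    ring
  have hX := (hcop.mul_right hcop).pow_left.dvd_of_dvd_mul_left hrev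
  rw [X_pow_dvd_iff] at hX
  have h0 := hX 0 (by norm_num)
  have h1 := hX 1 (by norm_num)
  rw [coeff_reflect, revAt_le (by norm_num)] at h0 h1
  refine ⟨r.coeff 0, ?_⟩
  have : r = C (r.coeff 0) := by
    ext i
    rw [coeff_C]
    split_ifs with hi
    · rw [hi]
    · rcases (by omega : i = 1 ∨ i = 2 ∨ 2 < i) with rfl | rfl | hi
      · exact h1
      · exact h0
      · exact coeff_eq_zero_of_natDegree_lt (by omega)
  rw [mul_comm]
  congr 1

end

theorem quadratic_X_pow_card [Fintype F] (b0 b1 b2 : F) :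
    quadratic (C b0) (C b1) (C b2) X ^ Fintype.card F =
      quadratic (C b0) (C b1) (C b2) (X ^ Fintype.card F) := by
  rw [← FiniteField.expand_card]
  simp [quadratic]

theorem quartic_X_pow_card [Fintype F] (n0 n1 n2 n3 n4 : F) :
    quartic (C n0) (C n1) (C n2) (C n3) (C n4) X ^ Fintype.card F =
      quartic (C n0) (C n1) (C n2) (C n3) (C n4) (X ^ Fintype.card F) := by
  rw [← FiniteField.expand_card]
  simp [quartic]

theorem exists_root_quadratic {K : Type*} [Field K] [IsAlgClosed K] (b n : K) :
    ∃ y, y ^ 2 + b * y + n = 0 := by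
  obtain ⟨y, hy⟩ := IsAlgClosed.exists_aeval_eq_zero K (X ^ 2 + C b * X + C n) (by
    have : (X ^ 2 + C b * X + C n).degree = 2 := by compute_degree!
    rw [this]
    decide)
  exact ⟨y, by simpa using hy⟩

theorem traceSeq_card_succ_relation [Fintype F] (b0 b1 b2 n0 n1 n2 n3 n4 : F) {B B' N N' W : F[X]}
    (hB : B = quadratic (C b0) (C b1) (C b2) X)
    (hB' : B' = quadratic (C b0) (C b1) (C b2) (X ^ Fintype.card F))
    (hN : N = quartic (C n0) (C n1) (C n2) (C n3) (C n4) X)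
    (hN' : N' = quartic (C n0) (C n1) (C n2) (C n3) (C n4) (X ^ Fintype.card F))
    (hW : W = traceSeq B N (Fintype.card F + 1)) :
    W * (B * B' - W) - N' * B ^ 2 - N * B' ^ 2 + 4 * N * N' = 0 := by
  rw [← quadratic_X_pow_card, ← hB] at hB'
  rw [← quartic_X_pow_card, ← hN] at hN'
  let Ω := AlgebraicClosure (FractionRing F[X])
  let ι := (algebraMap (FractionRing F[X]) Ω).comp (algebraMap F[X] (FractionRing F[X]))
  have hι : Function.Injective ι :=
    (algebraMap (FractionRing F[X]) Ω).injective.comp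
      (IsFractionRing.injective F[X] (FractionRing F[X]))
  obtain ⟨y, hy⟩ := exists_root_quadratic (ι B) (ι N)
  have e1 : ι B = -(y + (-ι B - y)) := by ring
  have e2 : ι N = y * (-ι B - y) := by linear_combination hy
  have e3 : ι W = _ := congrArg ι hW
  rw [map_traceSeq, traceSeq_eq e1 e2, pow_succ, pow_succ] at e3
  generalize -ι B - y = y' at e1 e2 e3
  have e4 : ι B' = -(y ^ Fintype.card F + y' ^ Fintype.card F) := by
    have := congrArg (FiniteField.frobeniusAlgHom F Ω) e1
    simpa only [map_neg, map_add, FiniteField.frobeniusAlgHom_apply, ← map_pow, ← hB'] using this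
  have e5 : ι N' = y ^ Fintype.card F * y' ^ Fintype.card F := by
    rw [hN', map_pow, e2, mul_pow]
  apply hι
  simp only [map_add, map_sub, map_mul, map_pow, map_zero, map_ofNat]
  rw [e1, e2, e3, e4, e5]
  ring

theorem coeff_eq_zero_of_symmetric_form {q : ℕ} (hq : 1 < q) {t00 t10 t20 t11 t21 t22 : F}
    (h : C t00 + C t10 * (X + X ^ q) + C t20 * (X ^ 2 + (X ^ q) ^ 2) + C t11 * (X * X ^ q) +
      C t21 * (X * X ^ q * (X + X ^ q)) + C t22 * (X ^ 2 * (X ^ q) ^ 2) = 0) :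
    t00 = 0 ∧ t10 = 0 ∧ t20 = 0 := by
  have h' : C t00 * X ^ 0 + C t10 * X ^ 1 + C t10 * X ^ q + C t20 * X ^ 2 + C t20 * X ^ (2 * q) +
      C t11 * X ^ (q + 1) + C t21 * X ^ (q + 2) + C t21 * X ^ (2 * q + 1) +
      C t22 * X ^ (2 * q + 2) = 0 := by
    rw [← h]
    ring
  have key (k : ℕ) := congrArg (fun p : F[X] => p.coeff k) h'
  simp only [coeff_add, coeff_C_mul, coeff_X_pow, coeff_zero] at key
  have h0 := key 0
  have h1 := key 1
  have h2 := key (2 * q + 1)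
  have h3 := key (2 * q)
  simp (disch := omega) only [if_neg, ↓reduceIte, mul_zero, mul_one, add_zero, zero_add]
    at h0 h1 h2 h3
  simp only [h2, zero_mul, add_zero] at h3
  exact ⟨h0, h1, h3⟩

theorem exists_trace_relation [Fintype F] {b0 b1 b2 n0 n1 n2 n3 n4 : F}
    (h : ∀ t z : F, z ^ 2 + quadratic b0 b1 b2 t * z + quartic n0 n1 n2 n3 n4 t ≠ 0)
    (hinf : ∀ z : F, z ^ 2 + b2 * z + n4 ≠ 0) :
    ∃ c : F,
      b0 * b1 * n1 + b0 ^ 2 * c + 4 * n0 * n2 - b0 ^ 2 * n2 - b1 ^ 2 * n0 - n1 ^ 2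
        - 4 * n0 * c = 0 ∧
      b0 * b1 * c + b0 * b2 * n1 + 4 * n0 * n3 - b0 ^ 2 * n3 - 2 * b1 * b2 * n0
        - 2 * n1 * c = 0 ∧
      b0 * b2 * c + 4 * n0 * n4 - b0 ^ 2 * n4 - b2 ^ 2 * n0 - c ^ 2 = 0 := by
  obtain ⟨c, hc⟩ := exists_frobDefect_eq h hinf
  refine ⟨c, ?_⟩
  have hE := traceSeq_card_succ_relation b0 b1 b2 n0 n1 n2 n3 n4 rfl rfl rfl rfl rfl
  rw [frobDefect, sub_eq_iff_eq_add] at hc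
  rw [hc] at hE
  refine coeff_eq_zero_of_symmetric_form (q := Fintype.card F) Fintype.one_lt_card
    (t11 := b1 ^ 2 * c + 2 * b0 * b2 * n2 + 2 * c ^ 2 + 2 * n1 * n3 + 8 * n0 * n4 - b0 * b1 * n3
      - b1 * b2 * n1 - 2 * b0 ^ 2 * n4 - 2 * b2 ^ 2 * n0 - 4 * n2 * c)
    (t21 := b0 * b2 * n3 + b1 * b2 * c + 4 * n1 * n4 - b2 ^ 2 * n1 - 2 * b0 * b1 * n4
      - 2 * n3 * c)
    (t22 := b1 * b2 * n3 + b2 ^ 2 * c + 4 * n2 * n4 - b1 ^ 2 * n4 - b2 ^ 2 * n2 - n3 ^ 2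
      - 4 * n4 * c) ?_
  have hX : (X ^ Fintype.card F - X : F[X]) ^ 2 ≠ 0 :=
    pow_ne_zero 2 (FiniteField.X_pow_card_sub_X_ne_zero F Fintype.one_lt_card)
  refine mul_left_cancel₀ hX (Eq.trans ?_ (hE.trans (mul_zero _).symm))
  simp only [quadratic, quartic, polarQuartic, map_add, map_sub, map_mul, map_pow, map_ofNat]
  ring

theorem aeval_ne_zero_of_odd_finrank {E : Type*} [Field E] [Algebra F E]
    (hE : Odd (Module.finrank F E)) {p : F[X]} (hp : p.natDegree ≤ 2)
    (h : ∀ t, p.eval t ≠ 0) (x : E) : aeval x p ≠ 0 := by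
  intro hx
  have hp0 : p ≠ 0 := by
    rintro rfl
    exact h 0 eval_zero
  have : FiniteDimensional F E := Module.finite_of_finrank_pos hE.pos
  have hle := natDegree_le_of_dvd (minpoly.dvd F x hx) hp0
  have hpos := minpoly.natDegree_pos (Algebra.IsIntegral.isIntegral (R := F) x)
  have hodd : Odd (minpoly F x).natDegree := hE.of_dvd_nat (minpoly.degree_dvd
    (Algebra.IsIntegral.isIntegral x))
  have h1 : (minpoly F x).natDegree = 1 := by
    obtain ⟨k, hk⟩ := hodd
    omega
  obtain ⟨t, rfl⟩ := minpoly.natDegree_eq_one_iff.1 h1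
  rw [aeval_algebraMap_apply, map_eq_zero, coe_aeval_eq_eval] at hx
  exact h t hx

theorem quadratic_ne_zero_of_odd_finrank {E : Type*} [Field E] [Algebra F E]
    (hE : Odd (Module.finrank F E)) {a b c : F} (h : ∀ t, a + b * t + c * t ^ 2 ≠ 0) (x : E) :
    algebraMap F E a + algebraMap F E b * x + algebraMap F E c * x ^ 2 ≠ 0 := by
  have := aeval_ne_zero_of_odd_finrank hE (natDegree_quadratic_C_le a b c)
    (by simpa [quadratic] using h) x
  simpa [quadratic] using this

theorem exists_root_of_discrim_eq_zero [Finite F] {b n : F} (h : b ^ 2 = 4 * n) :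
    ∃ z, z ^ 2 + b * z + n = 0 := by
  by_cases h2 : (2 : F) = 0
  · have : CharP F 2 := CharTwo.of_one_ne_zero_of_two_eq_zero one_ne_zero h2
    obtain ⟨z, rfl⟩ := FiniteField.isSquare_of_char_two (ringChar.eq F 2 ▸ rfl) n
    have hb : b = 0 := by
      have : b ^ 2 = 0 := by linear_combination h + 2 * z * z * h2
      simpa using this
    refine ⟨z, ?_⟩
    rw [hb]
    linear_combination z ^ 2 * h2
  · refine ⟨-b / 2, ?_⟩
    field_simp
    linear_combination -h

theorem sq_eq_of_trace_relation {E K : Type*} [Field E] [Field K] [Algebra E K] {b b' n n' m z : E}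
    (hz : z ^ 2 + b * z + n = 0) (h' : ∀ w : E, w ^ 2 + b' * w + n' ≠ 0) {y : K}
    (hy : y ^ 2 + algebraMap E K b' * y + algebraMap E K n' = 0)
    (hm : m * (b * b' - m) = n' * b ^ 2 + n * b' ^ 2 - 4 * n * n') : b ^ 2 = 4 * n := by
  by_contra hne
  have hz' : 2 * z + b ≠ 0 := by
    intro h0
    apply hne
    linear_combination (2 * z + b) * h0 - 4 * hz
  have hy' (w : E) : y ≠ algebraMap E K w := by
    rintro rfl
    apply h' w
    apply (algebraMap E K).injective
    simpa using hy
  have hz'' : algebraMap E K (2 * z + b) ≠ 0 := (_root_.map_ne_zero _).2 hz'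
  have hzK := congrArg (algebraMap E K) hz
  have hmK := congrArg (algebraMap E K) hm
  have hyd (w : E) : algebraMap E K (2 * z + b) * y ≠ algebraMap E K w := by
    intro hw
    apply hy' (w / (2 * z + b))
    rw [map_div₀, eq_div_iff hz'', ← hw, mul_comm]
  simp only [map_add, map_sub, map_mul, map_pow, map_ofNat, map_zero] at hzK hmK
  have hprod : (algebraMap E K (2 * z + b) * y - algebraMap E K (m - b' * (b + z))) *
      (algebraMap E K (2 * z + b) * y - algebraMap E K (-(b' * z) - m)) = 0 := by
    simp only [map_add, map_sub, map_mul, map_neg, map_ofNat]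
    linear_combination (2 * algebraMap E K z + algebraMap E K b) ^ 2 * hy +
      (algebraMap E K b' ^ 2 - 4 * algebraMap E K n') * hzK + hmK
  rcases mul_eq_zero.1 hprod with h | h
  · exact hyd _ (sub_eq_zero.1 h)
  · exact hyd _ (sub_eq_zero.1 h)

theorem family_ne_zero_of_odd_finrank [Fintype F] {E : Type*} [Field E] [Algebra F E]
    (hE : Odd (Module.finrank F E)) {b0 b1 b2 n0 n1 n2 n3 n4 : F}
    (h : ∀ t z : F, z ^ 2 + quadratic b0 b1 b2 t * z + quartic n0 n1 n2 n3 n4 t ≠ 0)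
    (hinf : ∀ z : F, z ^ 2 + b2 * z + n4 ≠ 0) (x z : E) :
    z ^ 2 + quadratic (algebraMap F E b0) (algebraMap F E b1) (algebraMap F E b2) x * z +
      quartic (algebraMap F E n0) (algebraMap F E n1) (algebraMap F E n2) (algebraMap F E n3)
        (algebraMap F E n4) x ≠ 0 := by
  intro hz
  obtain ⟨c, h0, h1, h2⟩ := exists_trace_relation h hinf
  have hdisc (t : F) : quadratic b0 b1 b2 t ^ 2 - 4 * quartic n0 n1 n2 n3 n4 t ≠ 0 := by
    intro ht
    obtain ⟨z, hz⟩ := exists_root_of_discrim_eq_zero (sub_eq_zero.1 ht)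
    exact h t z hz
  have hdisc0 : b0 ^ 2 - 4 * n0 ≠ 0 := by simpa [quadratic, quartic] using hdisc 0
  have hroot0 (z : F) : n0 + b0 * z + 1 * z ^ 2 ≠ 0 := by
    have := h 0 z
    simp only [quadratic, quartic] at this
    contrapose! this
    linear_combination this
  have hrootE (w : E) : w ^ 2 + algebraMap F E b0 * w + algebraMap F E n0 ≠ 0 := by
    have := quadratic_ne_zero_of_odd_finrank hE hroot0 w
    contrapose! this
    simpa only [map_one] using by linear_combination this
  have hK (t : F) : (4 * n0 - b0 ^ 2) + (2 * n1 - b0 * b1) * t + (2 * c - b0 * b2) * t ^ 2 ≠ 0 := by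
    intro ht
    apply mul_ne_zero (hdisc t) hdisc0
    simp only [quadratic, quartic]
    linear_combination ((4 * n0 - b0 ^ 2) + (2 * n1 - b0 * b1) * t + (2 * c - b0 * b2) * t ^ 2) *
      ht + 4 * t ^ 2 * (h0 + t * h1 + t ^ 2 * h2)
  have hKE := quadratic_ne_zero_of_odd_finrank hE hK x
  obtain ⟨y, hy⟩ := exists_root_quadratic (algebraMap E (AlgebraicClosure E) (algebraMap F E b0))
    (algebraMap E (AlgebraicClosure E) (algebraMap F E n0))
  have h0E := congrArg (algebraMap F E) h0
  have h1E := congrArg (algebraMap F E) h1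
  have h2E := congrArg (algebraMap F E) h2
  simp only [map_add, map_sub, map_mul, map_pow, map_ofNat, map_zero] at h0E h1E h2E hKE
  have hm := sq_eq_of_trace_relation (m := algebraMap F E c * x ^ 2 + algebraMap F E n1 * x +
    2 * algebraMap F E n0) hz hrootE hy (by
      simp only [quadratic, quartic]
      linear_combination x ^ 2 * (h0E + x * h1E + x ^ 2 * h2E))
  apply hKE
  rw [← sq_eq_zero_iff]
  simp only [quadratic, quartic] at hm
  linear_combination (algebraMap F E b0 ^ 2 - 4 * algebraMap F E n0) * hm -
    4 * x ^ 2 * (h0E + x * h1E + x ^ 2 * h2E)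

theorem exists_sq_add_mul_add_sq_eq [Finite F] (h3 : (3 : F) ≠ 0) (m : F) :
    ∃ u v : F, u ^ 2 + u * v + v ^ 2 = m := by
  have := Fintype.ofFinite F
  by_cases h2 : (2 : F) = 0
  · have : CharP F 2 := CharTwo.of_one_ne_zero_of_two_eq_zero one_ne_zero h2
    obtain ⟨z, rfl⟩ := FiniteField.isSquare_of_char_two (ringChar.eq F 2 ▸ rfl) m
    exact ⟨z, 0, by ring⟩
  · have hcard : Fintype.card F % 2 = 1 :=
      FiniteField.odd_card_of_char_ne_two fun h => h2 (by
        have := ringChar.Nat.cast_ringChar (R := F)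
        rw [h] at this
        exact_mod_cast this)
    obtain ⟨w, v, hwv⟩ := FiniteField.exists_root_sum_quadratic (f := X ^ 2)
      (g := C 3 * X ^ 2 + C 0 * X + C (-4 * m)) (degree_X_pow 2) (degree_quadratic h3) hcard
    simp only [eval_pow, eval_X, eval_add, eval_mul, eval_C] at hwv
    refine ⟨(w - v) / 2, v, ?_⟩
    field_simp
    linear_combination hwv

theorem conic_const_eq [Finite F] (h3 : (3 : F) ≠ 0) {a b c : F} (ha : a ≠ 0)
    (h : ∀ u v : F, u ≠ v → a * (u ^ 2 + u * v + v ^ 2) + b * (u + v) + c ≠ 0) :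
    3 * a * c = b ^ 2 := by
  by_contra hc
  obtain ⟨u, v, huv⟩ := exists_sq_add_mul_add_sq_eq h3 (-(c - b ^ 2 / (3 * a)) / a)
  have hzero (U V : F) (hUV : U ^ 2 + U * V + V ^ 2 = -(c - b ^ 2 / (3 * a)) / a) :
      a * ((U - b / (3 * a)) ^ 2 + (U - b / (3 * a)) * (V - b / (3 * a)) +
        (V - b / (3 * a)) ^ 2) + b * (U - b / (3 * a) + (V - b / (3 * a))) + c = 0 := by
    field_simp at hUV ⊢
    linear_combination 3 * hUV
  by_cases hne : u = v
  · subst hne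
    refine h _ _ ?_ (hzero u (-2 * u) (by rw [← huv]; ring))
    intro h0
    have hu : u = 0 := by
      have : 3 * u = 0 := by linear_combination h0
      exact (mul_eq_zero.1 this).resolve_left h3
    apply hc
    rw [hu] at huv
    field_simp at huv
    linear_combination huv
  · exact h _ _ (fun h0 => hne (by linear_combination h0)) (hzero u v huv)

theorem conic_ne_zero_of_odd_finrank [Finite F] {E : Type*} [Field E] [Algebra F E]
    (hE : Odd (Module.finrank F E)) {a b c : F} (ha : a ≠ 0)
    (h : ∀ u v : F, u ≠ v → a * (u ^ 2 + u * v + v ^ 2) + b * (u + v) + c ≠ 0)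
    {u v : E} (huv : u ≠ v) :
    algebraMap F E a * (u ^ 2 + u * v + v ^ 2) + algebraMap F E b * (u + v) +
      algebraMap F E c ≠ 0 := by
  intro h0
  have haE : algebraMap F E a ≠ 0 := (_root_.map_ne_zero _).2 ha
  by_cases h3 : (3 : F) = 0
  · have h3E : (3 : E) = 0 := by rw [← map_ofNat (algebraMap F E), h3, map_zero]
    have hb : b = 0 := by
      by_contra hb
      refine h (2 + (a + c) / b) (1 + (a + c) / b)
        (fun h21 => one_ne_zero (α := F) (by linear_combination h21)) ?_
      field_simp
      linear_combination (2 * a * b ^ 2 + 3 * a * b * (a + c) + a * (a + c) ^ 2 + b ^ 3 +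
        b ^ 2 * (a + c)) * h3
    rw [hb, map_zero, zero_mul, add_zero] at h0
    by_cases hc : c = 0
    · rw [hc, map_zero, add_zero] at h0
      apply mul_ne_zero haE (pow_ne_zero 2 (sub_ne_zero.2 huv))
      linear_combination h0 - algebraMap F E a * u * v * h3E
    · have hroot (t : F) : c + 0 * t + a * t ^ 2 ≠ 0 := by
        rcases eq_or_ne t 0 with rfl | ht
        · simpa using hc
        · have := h t 0 ht
          rw [hb] at this
          contrapose! this
          linear_combination this
      apply quadratic_ne_zero_of_odd_finrank hE hroot (u - v)
      rw [map_zero]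
      linear_combination h0 - algebraMap F E a * u * v * h3E
  · have hc := conic_const_eq h3 ha h
    have h3E : (3 : E) ≠ 0 := by
      rw [← map_ofNat (algebraMap F E)]
      exact (_root_.map_ne_zero _).2 h3
    have hroot (t : F) : 1 + 1 * t + 1 * t ^ 2 ≠ 0 := by
      intro ht
      refine h (t - b / (3 * a)) (1 - b / (3 * a)) ?_ ?_
      · intro h1
        have : t = 1 := by linear_combination h1
        rw [this] at ht
        exact h3 (by linear_combination ht)
      · field_simp
        linear_combination 9 * a ^ 2 * ht + 3 * hc
    have hcE := congrArg (algebraMap F E) hc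
    simp only [map_mul, map_pow, map_ofNat] at hcE
    generalize algebraMap F E a = a' at *
    generalize algebraMap F E b = b' at *
    generalize algebraMap F E c = c' at *
    have hform : (3 * a' * u + b') ^ 2 + (3 * a' * u + b') * (3 * a' * v + b') +
        (3 * a' * v + b') ^ 2 = 0 := by
      linear_combination 9 * a' * h0 - 3 * hcE
    by_cases hv : 3 * a' * v + b' = 0
    · rw [hv] at hform
      have hu : 3 * a' * u + b' = 0 := by simpa using hform
      apply huv
      apply mul_left_cancel₀ (mul_ne_zero h3E haE)
      linear_combination hu - hv
    · apply quadratic_ne_zero_of_odd_finrank hE hroot ((3 * a' * u + b') / (3 * a' * v + b'))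
      rw [map_one]
      field_simp
      linear_combination hform

/-- The quotient of `f(x) g(t) - f(t) g(x)` by `x - t` for polynomials `f, g` of degree at most
three, in terms of the minors `pᵢⱼ = fᵢ gⱼ - fⱼ gᵢ`. -/
def cubicBezoutian {R : Type*} [CommRing R] (p10 p20 p30 p21 p31 p32 x t : R) : R :=
  p10 + p20 * (x + t) + p30 * (x ^ 2 + x * t + t ^ 2) + p21 * (x * t) +
    p31 * (x * t * (x + t)) + p32 * (x ^ 2 * t ^ 2)

theorem cubicBezoutian_ne_zero_of_degenerate [Finite F] {E : Type*} [Field E] [Algebra F E]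
    (hE : Odd (Module.finrank F E)) {p10 p20 p30 p21 p31 p32 : F}
    (hP : p10 * p32 - p20 * p31 + p30 * p21 = 0)
    (hA : ∀ t, quadratic p30 p31 p32 t ≠ 0)
    (hQ : ∀ x t, x ≠ t → cubicBezoutian p10 p20 p30 p21 p31 p32 x t ≠ 0)
    (h32 : p32 = 0) {x t : E} (hxt : x ≠ t) :
    cubicBezoutian (algebraMap F E p10) (algebraMap F E p20) (algebraMap F E p30)
      (algebraMap F E p21) (algebraMap F E p31) (algebraMap F E p32) x t ≠ 0 := by
  have h30 : p30 ≠ 0 := by simpa [quadratic] using hA 0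
  have h31 : p31 = 0 := by
    by_contra h31
    apply hA (-p30 / p31)
    rw [quadratic, h32]
    field_simp
    ring
  have h21 : p21 = 0 := by
    rw [h31, h32, mul_zero, mul_zero, sub_zero, zero_add] at hP
    exact (mul_eq_zero.1 hP).resolve_left h30
  rw [h31, h32, h21] at hQ ⊢
  have := conic_ne_zero_of_odd_finrank hE h30 (b := p20) (c := p10) (fun u v huv h0 =>
    hQ u v huv (by rw [cubicBezoutian]; linear_combination h0)) hxt
  contrapose! this
  rw [cubicBezoutian] at this
  simp only [map_zero] at this
  linear_combination this

theorem cubicBezoutian_shift {R : Type*} [CommRing R] (p10 p20 p30 p21 p31 p32 x t s : R) :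
    cubicBezoutian p10 p20 p30 p21 p31 p32 x t =
      cubicBezoutian (cubicBezoutian p10 p20 p30 p21 p31 p32 s s)
        (2 * s * quadratic p30 p31 p32 s + quadratic p20 (p30 + p21) p31 s)
        (quadratic p30 p31 p32 s) (p21 + 3 * s * p31 + 3 * s ^ 2 * p32) (p31 + 2 * s * p32) p32
        (x - s) (t - s) := by
  simp only [cubicBezoutian, quadratic]
  ring

theorem cubicBezoutian_ne_zero_of_isotropic [Finite F] {E : Type*} [Field E] [Algebra F E]
    (hE : Odd (Module.finrank F E)) {p30 p31 p32 : F}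
    (hA : ∀ t, quadratic p30 p31 p32 t ≠ 0)
    (hQ : ∀ x t, x ≠ t → cubicBezoutian 0 0 p30 0 p31 p32 x t ≠ 0) {x t : E} (hxt : x ≠ t) :
    cubicBezoutian 0 0 (algebraMap F E p30) 0 (algebraMap F E p31) (algebraMap F E p32) x t
      ≠ 0 := by
  have h30 : p30 ≠ 0 := by simpa [quadratic] using hA 0
  have h30E : algebraMap F E p30 ≠ 0 := (_root_.map_ne_zero _).2 h30
  have hzero {u : F} (hu : u ≠ 0) : p30 * u ^ 2 + p31 * u + p32 ≠ 0 := by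
    have := hA u⁻¹
    contrapose! this
    rw [quadratic]
    field_simp
    linear_combination this
  have key (u v : F) (huv : u ≠ v) : p30 * (u ^ 2 + u * v + v ^ 2) + p31 * (u + v) + p32 ≠ 0 := by
    by_cases hu : u = 0
    · subst hu
      have := hzero huv.symm
      contrapose! this
      linear_combination this
    by_cases hv : v = 0
    · subst hv
      have := hzero huv
      contrapose! this
      linear_combination this
    have := hQ u⁻¹ v⁻¹ (fun h => huv (inv_injective h))
    contrapose! this
    rw [cubicBezoutian]
    field_simp
    linear_combination this
  intro h0
  rw [cubicBezoutian] at h0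
  by_cases hx : x = 0
  · subst hx
    exact mul_ne_zero h30E (pow_ne_zero 2 hxt.symm) (by linear_combination h0)
  by_cases ht : t = 0
  · subst ht
    exact mul_ne_zero h30E (pow_ne_zero 2 hxt) (by linear_combination h0)
  refine conic_ne_zero_of_odd_finrank hE h30 key (u := x⁻¹) (v := t⁻¹)
    (fun h => hxt (inv_injective h)) ?_
  field_simp
  linear_combination h0

theorem cubicBezoutian_ne_zero_of_exists [Finite F] {E : Type*} [Field E] [Algebra F E]
    (hE : Odd (Module.finrank F E)) {p10 p20 p30 p21 p31 p32 : F}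
    (hP : p10 * p32 - p20 * p31 + p30 * p21 = 0)
    (hA : ∀ t, quadratic p30 p31 p32 t ≠ 0)
    (hQ : ∀ x t, x ≠ t → cubicBezoutian p10 p20 p30 p21 p31 p32 x t ≠ 0)
    {s : F} (hs : cubicBezoutian p10 p20 p30 p21 p31 p32 s s = 0) {x t : E} (hxt : x ≠ t) :
    cubicBezoutian (algebraMap F E p10) (algebraMap F E p20) (algebraMap F E p30)
      (algebraMap F E p21) (algebraMap F E p31) (algebraMap F E p32) x t ≠ 0 := by
  have hAs := hA s
  have h20 : 2 * s * quadratic p30 p31 p32 s + quadratic p20 (p30 + p21) p31 s = 0 := by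
    by_contra hne
    obtain ⟨r, hr⟩ : ∃ r, quadratic p30 p31 p32 s * r = -quadratic p20 (p30 + p21) p31 s :=
      ⟨_, mul_div_cancel₀ _ hAs⟩
    refine hQ (r - s) s ?_ ?_
    · intro h0
      apply hne
      linear_combination hr - quadratic p30 p31 p32 s * h0
    · simp only [cubicBezoutian, quadratic] at hs hr ⊢
      linear_combination hs + (r - 2 * s) * hr
  have h21 : p21 + 3 * s * p31 + 3 * s ^ 2 * p32 = 0 := by
    apply (mul_eq_zero.1 (_ : quadratic p30 p31 p32 s * _ = 0)).resolve_left hAs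
    simp only [cubicBezoutian, quadratic] at hs h20 ⊢
    linear_combination hP - p32 * hs + (p31 + 2 * s * p32) * h20
  have h := cubicBezoutian_ne_zero_of_isotropic hE (p30 := quadratic p30 p31 p32 s)
    (p31 := p31 + 2 * s * p32) (p32 := p32) (fun u => ?_) (fun u v huv => ?_)
    (x := x - algebraMap F E s) (t := t - algebraMap F E s) (fun h => hxt (sub_left_injective h))
  · have hsE := congrArg (algebraMap F E) hs
    have h20E := congrArg (algebraMap F E) h20
    have h21E := congrArg (algebraMap F E) h21
    simp only [cubicBezoutian, quadratic, map_add, map_mul, map_pow, map_ofNat, map_zero]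
      at h hsE h20E h21E
    rw [cubicBezoutian_shift (s := algebraMap F E s)]
    simp only [cubicBezoutian, quadratic]
    rwa [hsE, h20E, h21E]
  · have := hA (u + s)
    contrapose! this
    rw [← this]
    simp only [quadratic]
    ring
  · have := hQ (u + s) (v + s) (fun h => huv (add_left_injective s h))
    rwa [cubicBezoutian_shift (s := s), hs, h20, h21, add_sub_cancel_right,
      add_sub_cancel_right] at this

theorem cubicBezoutian_ne_zero_of_anisotropic [Finite F] {E : Type*} [Field E] [Algebra F E]
    (hE : Odd (Module.finrank F E)) {p10 p20 p30 p21 p31 p32 : F}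
    (hA : ∀ t, quadratic p30 p31 p32 t ≠ 0)
    (hQ : ∀ x t, cubicBezoutian p10 p20 p30 p21 p31 p32 x t ≠ 0) (h32 : p32 ≠ 0) (x t : E) :
    cubicBezoutian (algebraMap F E p10) (algebraMap F E p20) (algebraMap F E p30)
      (algebraMap F E p21) (algebraMap F E p31) (algebraMap F E p32) x t ≠ 0 := by
  have := Fintype.ofFinite F
  intro h0
  refine family_ne_zero_of_odd_finrank hE (b0 := p20) (b1 := p30 + p21) (b2 := p31)
    (n0 := p30 * p10) (n1 := p30 * p20 + p31 * p10) (n2 := p30 ^ 2 + p31 * p20 + p32 * p10)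
    (n3 := p31 * p30 + p32 * p20) (n4 := p32 * p30) (fun t z hz => ?_) (fun z hz => ?_) t
    (quadratic (algebraMap F E p30) (algebraMap F E p31) (algebraMap F E p32) t * x) ?_
  · have hAt := hA t
    obtain ⟨w, rfl⟩ : ∃ w, z = quadratic p30 p31 p32 t * w :=
      ⟨_, (mul_div_cancel₀ z hAt).symm⟩
    apply hQ w t
    apply (mul_eq_zero.1 (_ : quadratic p30 p31 p32 t * _ = 0)).resolve_left hAt
    simp only [cubicBezoutian, quadratic, quartic] at hz ⊢
    linear_combination hz
  · apply hA (z / p32)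
    rw [quadratic]
    field_simp
    linear_combination hz
  · simp only [cubicBezoutian, quadratic, quartic, map_add, map_mul, map_pow] at *
    linear_combination (algebraMap F E p30 + algebraMap F E p31 * t + algebraMap F E p32 * t ^ 2)
      * h0

theorem cubicBezoutian_ne_zero_of_odd_finrank [Finite F] {E : Type*} [Field E] [Algebra F E]
    (hE : Odd (Module.finrank F E)) {p10 p20 p30 p21 p31 p32 : F}
    (hP : p10 * p32 - p20 * p31 + p30 * p21 = 0)
    (hA : ∀ t, quadratic p30 p31 p32 t ≠ 0)
    (hQ : ∀ x t, x ≠ t → cubicBezoutian p10 p20 p30 p21 p31 p32 x t ≠ 0) {x t : E} (hxt : x ≠ t) :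
    cubicBezoutian (algebraMap F E p10) (algebraMap F E p20) (algebraMap F E p30)
      (algebraMap F E p21) (algebraMap F E p31) (algebraMap F E p32) x t ≠ 0 := by
  by_cases h32 : p32 = 0
  · exact cubicBezoutian_ne_zero_of_degenerate hE hP hA hQ h32 hxt
  by_cases hs : ∃ s, cubicBezoutian p10 p20 p30 p21 p31 p32 s s = 0
  · obtain ⟨s, hs⟩ := hs
    exact cubicBezoutian_ne_zero_of_exists hE hP hA hQ hs hxt
  · push Not at hs
    refine cubicBezoutian_ne_zero_of_anisotropic hE hA (fun y s => ?_) h32 x t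
    rcases eq_or_ne y s with rfl | h
    · exact hs y
    · exact hQ y s h

end

/-- The value of `p`, seen as a binary cubic form, at a point of the projective line. -/
def cubicEval {F : Type*} [Field F] (p : F[X]) : Option F → F
  | some a => p.eval a
  | none => p.coeff 3

theorem cubicEval_ne_zero_or {F : Type*} [Field F] {f g : F[X]} (hfg : IsCoprime f g)
    (hdeg : max f.natDegree g.natDegree = 3) (u : Option F) :
    cubicEval f u ≠ 0 ∨ cubicEval g u ≠ 0 := by
  cases u with
  | none =>
    rcases max_choice f.natDegree g.natDegree with h | h
    · left
      rw [cubicEval, ← hdeg, h, coeff_natDegree, leadingCoeff_ne_zero]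
      rintro rfl
      simp_all
    · right
      rw [cubicEval, ← hdeg, h, coeff_natDegree, leadingCoeff_ne_zero]
      rintro rfl
      simp_all
  | some a =>
    by_contra! h
    obtain ⟨r, s, hrs⟩ := hfg
    have := congrArg (eval a) hrs
    simp only [cubicEval] at h
    simp [h.1, h.2] at this

theorem ratEval_eq_some {F : Type} [Field F] {f g : F[X]}
    (hdeg : max f.natDegree g.natDegree = 3) {u : Option F} (hu : cubicEval g u ≠ 0) :
    ratEval f g u = some (cubicEval f u / cubicEval g u) := by
  cases u with
  | some a => exact if_pos hu
  | none =>
    have hg : g.natDegree = 3 :=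
      le_antisymm (hdeg ▸ le_max_right _ _) (le_natDegree_of_ne_zero hu)
    have hf : f.natDegree ≤ 3 := hdeg ▸ le_max_left _ _
    simp only [ratEval, cubicEval, leadingCoeff, hg]
    rw [if_neg (by omega)]
    split_ifs with h
    · rw [coeff_eq_zero_of_natDegree_lt h, zero_div]
    · rw [show f.natDegree = 3 by omega]

theorem ratEval_eq_none {F : Type} [Field F] {f g : F[X]}
    (hdeg : max f.natDegree g.natDegree = 3) {u : Option F} (hu : cubicEval g u = 0)
    (hu' : cubicEval f u ≠ 0) : ratEval f g u = none := by
  cases u with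
  | some a => exact if_neg (not_not.2 hu)
  | none =>
    have hf : f.natDegree = 3 :=
      le_antisymm (hdeg ▸ le_max_left _ _) (le_natDegree_of_ne_zero hu')
    have hg : g.natDegree ≤ 3 := hdeg ▸ le_max_right _ _
    refine if_pos (lt_of_le_of_ne (hf ▸ hg) fun h => ?_)
    rw [cubicEval, ← hf, ← h, coeff_natDegree, leadingCoeff_eq_zero] at hu
    simp_all

theorem ratEval_eq_iff {F : Type} [Field F] {f g : F[X]} (hfg : IsCoprime f g)
    (hdeg : max f.natDegree g.natDegree = 3) (u v : Option F) :
    ratEval f g u = ratEval f g v ↔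
      cubicEval f u * cubicEval g v - cubicEval f v * cubicEval g u = 0 := by
  have h1 := cubicEval_ne_zero_or hfg hdeg u
  have h2 := cubicEval_ne_zero_or hfg hdeg v
  by_cases hu : cubicEval g u = 0 <;> by_cases hv : cubicEval g v = 0
  · simp_all [ratEval_eq_none hdeg]
  · simp_all [ratEval_eq_none hdeg, ratEval_eq_some hdeg]
  · simp_all [ratEval_eq_none hdeg, ratEval_eq_some hdeg]
  · rw [ratEval_eq_some hdeg hu, ratEval_eq_some hdeg hv, Option.some_inj, div_eq_div_iff hu hv,
      sub_eq_zero]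

/-- The minor `fᵢ gⱼ - fⱼ gᵢ` of the coefficients of `f` and `g`. -/
def coeffMinor {R : Type*} [CommRing R] (f g : R[X]) (i j : ℕ) : R :=
  f.coeff i * g.coeff j - f.coeff j * g.coeff i

theorem coeffMinor_map {R S : Type*} [CommRing R] [CommRing S] (φ : R →+* S) (f g : R[X])
    (i j : ℕ) : coeffMinor (f.map φ) (g.map φ) i j = φ (coeffMinor f g i j) := by
  simp [coeffMinor]

theorem ratEval_injective_iff {F : Type} [Field F] {f g : F[X]} (hfg : IsCoprime f g)
    (hdeg : max f.natDegree g.natDegree = 3) :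
    Function.Injective (ratEval f g) ↔
      (∀ t, quadratic (coeffMinor f g 3 0) (coeffMinor f g 3 1) (coeffMinor f g 3 2) t ≠ 0) ∧
      ∀ x t, x ≠ t → cubicBezoutian (coeffMinor f g 1 0) (coeffMinor f g 2 0) (coeffMinor f g 3 0)
        (coeffMinor f g 2 1) (coeffMinor f g 3 1) (coeffMinor f g 3 2) x t ≠ 0 := by
  have heval {p : F[X]} (hp : p.natDegree ≤ 3) (a : F) : cubicEval p (some a) =
      p.coeff 0 + p.coeff 1 * a + p.coeff 2 * a ^ 2 + p.coeff 3 * a ^ 3 := by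
    rw [cubicEval, eval_eq_sum_range' (Nat.lt_succ_of_le hp)]
    simp [Finset.sum_range_succ]
  have hf : f.natDegree ≤ 3 := hdeg ▸ le_max_left _ _
  have hg : g.natDegree ≤ 3 := hdeg ▸ le_max_right _ _
  have hinf (t : F) : ratEval f g none = ratEval f g (some t) ↔
      quadratic (coeffMinor f g 3 0) (coeffMinor f g 3 1) (coeffMinor f g 3 2) t = 0 := by
    rw [ratEval_eq_iff hfg hdeg, heval hf, heval hg, cubicEval, cubicEval]
    simp only [quadratic, coeffMinor]
    refine Eq.congr_left ?_
    ring
  have hsome (x t : F) (hxt : x ≠ t) : ratEval f g (some x) = ratEval f g (some t) ↔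
      cubicBezoutian (coeffMinor f g 1 0) (coeffMinor f g 2 0) (coeffMinor f g 3 0)
        (coeffMinor f g 2 1) (coeffMinor f g 3 1) (coeffMinor f g 3 2) x t = 0 := by
    rw [ratEval_eq_iff hfg hdeg, heval hf, heval hg, heval hf, heval hg]
    refine Iff.trans ?_ (mul_eq_zero_iff_left (sub_ne_zero.2 hxt))
    simp only [cubicBezoutian, coeffMinor]
    refine Eq.congr_left ?_
    ring
  constructor
  · refine fun h => ⟨fun t ht => ?_, fun x t hxt h0 => ?_⟩
    · exact absurd (h ((hinf t).2 ht)) (Option.some_ne_none t).symm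
    · exact hxt (Option.some_injective _ (h ((hsome x t hxt).2 h0)))
  · rintro ⟨hA, hQ⟩ (_ | x) (_ | t) h
    · rfl
    · exact absurd ((hinf t).1 h) (hA t)
    · exact absurd ((hinf x).1 h.symm) (hA x)
    · by_contra hne
      have hxt : x ≠ t := fun h => hne (congrArg some h)
      exact hQ x t hxt ((hsome x t hxt).1 h)

theorem ratEval_map_bijective_iff {F E : Type} [Field F] [Field E] [Finite E] [Algebra F E]
    {f g : F[X]} (hfg : IsCoprime f g) (hdeg : max f.natDegree g.natDegree = 3) :
    Function.Bijective (ratEval (f.map (algebraMap F E)) (g.map (algebraMap F E))) ↔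
      (∀ t : E, quadratic (algebraMap F E (coeffMinor f g 3 0))
        (algebraMap F E (coeffMinor f g 3 1)) (algebraMap F E (coeffMinor f g 3 2)) t ≠ 0) ∧
      ∀ x t : E, x ≠ t → cubicBezoutian (algebraMap F E (coeffMinor f g 1 0))
        (algebraMap F E (coeffMinor f g 2 0)) (algebraMap F E (coeffMinor f g 3 0))
        (algebraMap F E (coeffMinor f g 2 1)) (algebraMap F E (coeffMinor f g 3 1))
        (algebraMap F E (coeffMinor f g 3 2)) x t ≠ 0 := by
  have hfg' : IsCoprime (f.map (algebraMap F E)) (g.map (algebraMap F E)) :=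
    hfg.map (mapRingHom (algebraMap F E))
  rw [← Finite.injective_iff_bijective, ratEval_injective_iff hfg' (by simpa using hdeg)]
  simp only [coeffMinor_map]

theorem ratEval_bijective_iff {F : Type} [Field F] [Finite F]
    {f g : F[X]} (hfg : IsCoprime f g) (hdeg : max f.natDegree g.natDegree = 3) :
    Function.Bijective (ratEval f g) ↔
      (∀ t, quadratic (coeffMinor f g 3 0) (coeffMinor f g 3 1) (coeffMinor f g 3 2) t ≠ 0) ∧
      ∀ x t, x ≠ t → cubicBezoutian (coeffMinor f g 1 0) (coeffMinor f g 2 0) (coeffMinor f g 3 0)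
        (coeffMinor f g 2 1) (coeffMinor f g 3 1) (coeffMinor f g 3 2) x t ≠ 0 := by
  rw [← Finite.injective_iff_bijective, ratEval_injective_iff hfg hdeg]

theorem bijective_ratEval_map_of_odd_finrank {F E : Type} [Field F] [Finite F] [Field E] [Finite E]
    [Algebra F E] {f g : F[X]} (hfg : IsCoprime f g) (hdeg : max f.natDegree g.natDegree = 3)
    (hE : Odd (Module.finrank F E)) (h : Function.Bijective (ratEval f g)) :
    Function.Bijective (ratEval (f.map (algebraMap F E)) (g.map (algebraMap F E))) := by
  obtain ⟨hA, hQ⟩ := (ratEval_bijective_iff hfg hdeg).1 h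
  exact (ratEval_map_bijective_iff hfg hdeg).2
    ⟨quadratic_ne_zero_of_odd_finrank hE hA, fun x t => cubicBezoutian_ne_zero_of_odd_finrank hE
      (by simp only [coeffMinor]; ring) hA hQ⟩

theorem bijective_ratEval_of_map {F E : Type} [Field F] [Finite F] [Field E] [Finite E]
    [Algebra F E] {f g : F[X]} (hfg : IsCoprime f g) (hdeg : max f.natDegree g.natDegree = 3)
    (h : Function.Bijective (ratEval (f.map (algebraMap F E)) (g.map (algebraMap F E)))) :
    Function.Bijective (ratEval f g) := by
  obtain ⟨hA, hQ⟩ := (ratEval_map_bijective_iff hfg hdeg).1 h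
  refine (ratEval_bijective_iff hfg hdeg).2 ⟨fun t ht => hA (algebraMap F E t) ?_,
    fun x t hxt h0 => hQ (algebraMap F E x) (algebraMap F E t)
      (fun h => hxt ((algebraMap F E).injective h)) ?_⟩
  · simpa [quadratic] using congrArg (algebraMap F E) ht
  · simpa [cubicBezoutian] using congrArg (algebraMap F E) h0

theorem stmt_18 (F : Type) [Field F] [Fintype F] (φ : RatFunc F)
    (hdeg : max φ.num.natDegree φ.denom.natDegree = 3) :
    Function.Bijective (ratEval φ.num φ.denom) ↔
      {n : ℕ | 0 < n ∧ ∀ (E : Type) [Field E] [Algebra F E] [Fintype E],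
        Fintype.card E = Fintype.card F ^ n →
        Function.Bijective
          (ratEval (φ.num.map (algebraMap F E)) (φ.denom.map (algebraMap F E)))}.Infinite := by
  have hco := RatFunc.isCoprime_num_denom φ
  constructor
  · refine fun h => Nat.frequently_atTop_iff_infinite.1
      (Nat.frequently_odd.mono fun n hn => ⟨hn.pos, fun E _ _ _ hcard => ?_⟩)
    refine bijective_ratEval_map_of_odd_finrank hco hdeg ?_ h
    have hpow := Module.card_eq_pow_finrank (K := F) (V := E)
    rwa [← Nat.pow_right_injective Fintype.one_lt_card (hcard.symm.trans hpow)]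
  · intro h
    obtain ⟨n, hn, hbij⟩ := h.nonempty
    obtain ⟨p, hp⟩ := CharP.exists F
    have : Fact p.Prime := ⟨CharP.char_is_prime F p⟩
    have : NeZero n := ⟨hn.ne'⟩
    let E := FiniteField.Extension F p n
    have : Fintype E := Fintype.ofFinite E
    refine bijective_ratEval_of_map (E := E) hco hdeg (hbij E ?_)
    rw [← Nat.card_eq_fintype_card, ← Nat.card_eq_fintype_card, FiniteField.natCard_extension]

end
end
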